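/- arXiv:math/0409462 — 3 statements merged into one kernel-verified Lean document; each statement's English description precedes it below -/
import Mathlib

section
/- Let p0, p1, p2 ∈ R_{d1,d2} with d1, d2 > 0 be bihomogeneous polynomials with no common zeros on P^1 × P^1. Then the Koszul complex of p0, p1, p2 is exact at its first two steps: (i) the map h ↦ (h p2, −h p1, h p0) from R to R^3 is injective; and (ii) for every (B0, B1, B2) ∈ R^3 satisfying p1 B0 + p2 B1 = 0, −p0 B0 + p2 B2 = 0, and −p0 B1 − p1 B2 = 0, there exists h ∈ R with (B0, B1, B2) = (h p2, −h p1, h p0). -/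
open MvPolynomial

noncomputable section

/-- The bigraded polynomial ring `R = k[x,y,z,w]`; variables `0,1,2,3` are `x,y,z,w`. -/
abbrev Rk (k : Type*) [Field k] := MvPolynomial (Fin 4) k

/-- The bigrading: `x, y` have degree `(1,0)`; `z, w` have degree `(0,1)`. -/
def bidegWt : Fin 4 → ℤ × ℤ := ![(1, 0), (1, 0), (0, 1), (0, 1)]

/-- `p` is bihomogeneous of bidegree `(m, n)` (with the convention that only the zero
polynomial is bihomogeneous of a bidegree with a negative coordinate). -/
def Bihom {k : Type*} [Field k] (p : Rk k) (m n : ℤ) : Prop :=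
  p.IsWeightedHomogeneous bidegWt (m, n)

/-- `p0, p1, p2` have no common zeros on `ℙ¹ × ℙ¹`. -/
def NoCommonZeros {k : Type*} [Field k] (p0 p1 p2 : Rk k) : Prop :=
  ∀ a b c d : k, (a, b) ≠ (0, 0) → (c, d) ≠ (0, 0) →
    eval ![a, b, c, d] p0 ≠ 0 ∨ eval ![a, b, c, d] p1 ≠ 0 ∨ eval ![a, b, c, d] p2 ≠ 0

/-- The map `(A0, A1, A2) ↦ A0 p0 + A1 p1 + A2 p2`, as a `k`-linear map on `R³`. -/
def syzMapk {k : Type*} [Field k] (p : Fin 3 → Rk k) : (Fin 3 → Rk k) →ₗ[k] Rk k :=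
  ∑ i : Fin 3, (LinearMap.mulRight k (p i)).comp (LinearMap.proj i)

/-- The bigraded piece `Syz(p)_{m,n}`: triples `(A0, A1, A2)` of bihomogeneous polynomials of
bidegree `(m-2, n-1)` with `A0 p0 + A1 p1 + A2 p2 = 0`, as a `k`-subspace of `R³`. -/
def SyzPiece {k : Type*} [Field k] (p : Fin 3 → Rk k) (m n : ℤ) :
    Submodule k (Fin 3 → Rk k) :=
  (Submodule.pi Set.univ fun _ => weightedHomogeneousSubmodule k bidegWt (m - 2, n - 1)) ⊓
    LinearMap.ker (syzMapk p)

/-- The syzygy module `Syz(p)`, as an `R`-submodule of `R³`. -/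
def Syz {k : Type*} [Field k] (p : Fin 3 → Rk k) : Submodule (Rk k) (Fin 3 → Rk k) :=
  LinearMap.ker (∑ i : Fin 3, (LinearMap.mulRight (Rk k) (p i)).comp (LinearMap.proj i))

/-- The Koszul submodule of `R³`: the `R`-submodule generated by the three Koszul syzygies
`(p1, −p0, 0)`, `(p2, 0, −p0)`, `(0, p2, −p1)`. -/
def KoszulSub {k : Type*} [Field k] (p0 p1 p2 : Rk k) : Submodule (Rk k) (Fin 3 → Rk k) :=
  Submodule.span (Rk k) {![p1, -p0, 0], ![p2, 0, -p0], ![0, p2, -p1]}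

/-- `p0, p1, p2 ∈ R_{2,1}` are generic: only finitely many points `[a0 : a1 : a2]` of `ℙ²(k)`
are such that `a0 p0 + a1 p1 + a2 p2` factors as `q · l` with `q ∈ R_{2,0}`, `l ∈ R_{0,1}`. -/
def BidegGeneric {k : Type*} [Field k] (p0 p1 p2 : Rk k) : Prop :=
  {P : Projectivization k (Fin 3 → k) |
    ∃ q l : Rk k, Bihom q 2 0 ∧ Bihom l 0 1 ∧
      P.rep 0 • p0 + P.rep 1 • p1 + P.rep 2 • p2 = q * l}.Finite

/-- A vector proportional to a primitive vector over a unique factorization domain is a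
multiple of it. -/
theorem exists_eq_mul_of_forall_prime_not_dvd {ι R : Type*} [Fintype ι] [CommRing R] [IsDomain R]
    [UniqueFactorizationMonoid R] {a b : ι → R} (ha : a ≠ 0)
    (hprim : ∀ q : R, Prime q → ∃ i, ¬ q ∣ a i) (hab : ∀ i j, a i * b j = a j * b i) :
    ∃ h : R, ∀ i, b i = h * a i := by
  classical
  obtain ⟨_⟩ : Nonempty (NormalizedGCDMonoid R) := inferInstance
  obtain ⟨i, hi⟩ := Function.ne_iff.mp ha
  have hg0 : Finset.univ.gcd a ≠ 0 := fun h =>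
    hi (Finset.gcd_eq_zero_iff.mp h i (Finset.mem_univ i))
  have hunit : IsUnit (Finset.univ.gcd a) := by
    by_contra hu
    obtain ⟨q, hq, hdvd⟩ := WfDvdMonoid.exists_irreducible_factor hu hg0
    obtain ⟨j, hj⟩ := hprim q hq.prime
    exact hj (hdvd.trans (Finset.gcd_dvd (Finset.mem_univ j)))
  have hdvd : a i ∣ b i := by
    have h : a i ∣ Finset.univ.gcd fun j => b i * a j :=
      Finset.dvd_gcd fun j _ => ⟨b j, by rw [hab i j, mul_comm]⟩
    exact hunit.dvd_mul_right.mp (h.trans (Finset.gcd_mul_left' _ _ _).dvd)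
  obtain ⟨h, hh⟩ := hdvd
  refine ⟨h, fun j => mul_left_cancel₀ hi ?_⟩
  rw [hab i j, hh]
  ring

/-- Polynomials with no common zeros on `ℙ¹ × ℙ¹` have no common prime factor. -/
theorem NoCommonZeros.exists_not_dvd_of_prime {k : Type*} [Field k] [IsAlgClosed k]
    {p0 p1 p2 : Rk k} (hncz : NoCommonZeros p0 p1 p2) {q : Rk k} (hq : Prime q) :
    ∃ i, ¬ q ∣ (![p0, p1, p2] : Fin 3 → Rk k) i := by
  by_contra! hdvd
  have hzero (v : Fin 4 → k) (hv : eval v q = 0) :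
      (v 0, v 1) = (0, 0) ∨ (v 2, v 3) = (0, 0) := by
    by_contra! hne
    have hp (i : Fin 3) : eval v ((![p0, p1, p2] : Fin 3 → Rk k) i) = 0 :=
      zero_dvd_iff.mp (hv ▸ map_dvd (eval v) (hdvd i))
    have hvec : ![v 0, v 1, v 2, v 3] = v := by ext i; fin_cases i <;> rfl
    have := hncz (v 0) (v 1) (v 2) (v 3) hne.1 hne.2
    rw [hvec] at this
    rcases this with h | h | h
    exacts [h (hp 0), h (hp 1), h (hp 2)]
  have hmul (f : Rk k) (hf : ∀ v, eval v q = 0 → eval v f = 0) : q ∣ f := by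
    have : f ∈ (Ideal.span {q}).radical := by
      rw [← vanishingIdeal_zeroLocus_eq_radical (K := k)]
      intro v hv
      simpa [aeval_eq_eval] using hf v (by
        simpa [aeval_eq_eval] using hv q (Ideal.mem_span_singleton_self q))
    obtain ⟨n, hn⟩ := this
    exact hq.dvd_of_dvd_pow (Ideal.mem_span_singleton.mp hn)
  have hX (i j : Fin 4) (hi : q ∣ X i) (hj : q ∣ X j) : i = j := by
    have hirr (l : Fin 4) : Irreducible (X l : Rk k) := X_prime.irreducible
    have h : (X i : Rk k) ∣ X j :=
      ((hq.irreducible.associated_of_dvd (hirr i) hi).symm.dvd).trans hj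
    simpa [X_dvd_X] using h
  have h02 : q ∣ X 0 * X 2 := hmul _ fun v hv => by
    rcases hzero v hv with h | h <;> simp_all
  have h13 : q ∣ X 1 * X 3 := hmul _ fun v hv => by
    rcases hzero v hv with h | h <;> simp_all
  rcases hq.dvd_or_dvd h02 with h | h <;> rcases hq.dvd_or_dvd h13 with h' | h' <;>
    exact absurd (hX _ _ h h') (by decide)

/-- Polynomials with no common zeros on `ℙ¹ × ℙ¹` are not all zero. -/
theorem NoCommonZeros.ne_zero {k : Type*} [Field k] {p0 p1 p2 : Rk k}
    (hncz : NoCommonZeros p0 p1 p2) : (![p0, p1, p2] : Fin 3 → Rk k) ≠ 0 := by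
  intro h
  have hp (i : Fin 3) := congrFun h i
  have h0 : p0 = 0 := hp 0
  have h1 : p1 = 0 := hp 1
  have h2 : p2 = 0 := hp 2
  simpa [h0, h1, h2] using hncz 1 1 1 1 (by simp) (by simp)

/-- The Koszul complex of `p0, p1, p2` is exact at its first two steps:
(i) `h ↦ (h p2, −h p1, h p0)` is injective; (ii) every triple `(B0, B1, B2)` killed by the
second Koszul matrix is of the form `(h p2, −h p1, h p0)`. -/
theorem statement2 {k : Type*} [Field k] [IsAlgClosed k] (d1 d2 : ℤ)
    (hd1 : 0 < d1) (hd2 : 0 < d2) (p0 p1 p2 : Rk k)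
    (h0 : Bihom p0 d1 d2) (h1 : Bihom p1 d1 d2) (h2 : Bihom p2 d1 d2)
    (hncz : NoCommonZeros p0 p1 p2) :
    Function.Injective (fun h : Rk k => (![h * p2, -(h * p1), h * p0] : Fin 3 → Rk k)) ∧
      ∀ B0 B1 B2 : Rk k,
        p1 * B0 + p2 * B1 = 0 → -(p0 * B0) + p2 * B2 = 0 → -(p0 * B1) - p1 * B2 = 0 →
          ∃ h : Rk k, B0 =h * p2 ∧ B1 = -(h * p1) ∧ B2 = h * p0 := by
  constructor
  · intro g h hgh
    obtain ⟨i, hi⟩ := Function.ne_iff.mp hncz.ne_zero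
    have e0 : g * p2 = h * p2 := congrFun hgh 0
    have e1 : -(g * p1) = -(h * p1) := congrFun hgh 1
    have e2 : g * p0 = h * p0 := congrFun hgh 2
    fin_cases i
    exacts [mul_right_cancel₀ hi e2, mul_right_cancel₀ hi (neg_injective e1),
      mul_right_cancel₀ hi e0]
  · intro B0 B1 B2 e0 e1 e2
    obtain ⟨h, hh⟩ := exists_eq_mul_of_forall_prime_not_dvd
      (b := ![B2, -B1, B0]) hncz.ne_zero (fun q hq => hncz.exists_not_dvd_of_prime hq)
      (by
        intro i j
        fin_cases i <;> fin_cases j <;> simp <;> grind)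
    exact ⟨h, hh 2, neg_eq_iff_eq_neg.mp (hh 1), hh 0⟩
end
end

section
/- Let p0, p1, p2 ∈ R_{2,1} have no common zeros on P^1 × P^1. If p0, p1, p2 are non-generic, then dim_k Syz(p)_{2,n} = n − 2 for all n ≥ 3. -/
open MvPolynomial

noncomputable section

open Matrix in
/-- The quadrics spanned by the columns of `N` have no common zero on `ℙ¹`. -/
def NoCommonRoot {k : Type*} [Field k] (N : Matrix (Fin 3) (Fin 3) k) : Prop :=
  ∀ x y : k, (x, y) ≠ (0, 0) → ![x ^ 2, x * y, y ^ 2] ᵥ* N ≠ 0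

section Pointwise

open Matrix

variable {k : Type*} [Field k]

lemma exists_binary_quadratic_zero [IsAlgClosed k] (a b c : k) :
    ∃ x y : k, (x, y) ≠ (0, 0) ∧ a * x ^ 2 + b * (x * y) + c * y ^ 2 = 0 := by
  by_cases ha : a = 0
  · exact ⟨1, 0, by simp, by simp [ha]⟩
  · obtain ⟨x, hx⟩ := IsAlgClosed.exists_root
      (Polynomial.C a * Polynomial.X ^ 2 + Polynomial.C b * Polynomial.X + Polynomial.C c)
      (by rw [Polynomial.degree_quadratic ha]; decide)
    refine ⟨x, 1, by simp, ?_⟩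
    simpa [Polynomial.IsRoot.def] using hx

lemma NoCommonRoot.ne_vecMulVec [IsAlgClosed k] {N : Matrix (Fin 3) (Fin 3) k}
    (hN : NoCommonRoot N) (c r : Fin 3 → k) : N ≠ vecMulVec c r := by
  rintro rfl
  obtain ⟨x, y, hxy, h⟩ := exists_binary_quadratic_zero (c 0) (c 1) (c 2)
  refine hN x y hxy ?_
  ext i
  simp only [vecMul, dotProduct, Fin.sum_univ_three, vecMulVec_apply]
  simp
  linear_combination r i * h

lemma NoCommonRoot.sq_ne_mul {N : Matrix (Fin 3) (Fin 3) k} (hN : NoCommonRoot N)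
    {v : Fin 3 → k} (hv : v ≠ 0) (hvN : v ᵥ* N = 0) : v 1 ^ 2 - v 0 * v 2 ≠ 0 := by
  intro h
  by_cases h0 : v 0 = 0
  · have h1 : v 1 = 0 := by simpa [h0] using h
    have h2 : v 2 ≠ 0 := fun h2 => hv (by ext i; fin_cases i <;> simpa)
    refine hN 0 1 (by simp) ?_
    have : v = v 2 • ![(0 : k) ^ 2, 0 * 1, 1 ^ 2] := by ext i; fin_cases i <;> simp [h0, h1]
    rw [this, smul_vecMul] at hvN
    exact (smul_eq_zero.1 hvN).resolve_left h2
  · refine hN (v 0) (v 1) (by simp [h0]) ?_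
    have : ![v 0 ^ 2, v 0 * v 1, v 1 ^ 2] = v 0 • v := by
      ext i
      fin_cases i
      · simp [pow_two]
      · simp
      · simp; linear_combination h
    rw [this, smul_vecMul, hvN, smul_zero]

lemma eq_smul_of_cross_eq_zero {w r : Fin 3 → k} (hw : w ≠ 0) (h : w ⨯₃ r = 0) :
    ∃ c : k, r = c • w := by
  obtain ⟨j, hj⟩ := Function.ne_iff.1 hw
  have h0 := congrFun h 0
  have h1 := congrFun h 1
  have h2 := congrFun h 2
  simp [cross_apply] at h0 h1 h2 hj
  refine ⟨r j / w j, ?_⟩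
  ext i
  simp only [Pi.smul_apply, smul_eq_mul]
  field_simp
  fin_cases i <;> fin_cases j <;> simp <;> grind

lemma NoCommonRoot.cross_eq_zero_of_mulVec [IsAlgClosed k] {N : Matrix (Fin 3) (Fin 3) k}
    (hN : NoCommonRoot N) {a b : Fin 3 → k} (ha : N *ᵥ a = 0) (hb : N *ᵥ b = 0) :
    a ⨯₃ b = 0 := by
  by_contra hab
  have key : ∀ i, ∃ c : k, N i = c • (a ⨯₃ b) := by
    intro i
    apply eq_smul_of_cross_eq_zero hab
    have hai := congrFun ha i
    have hbi := congrFun hb i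
    simp only [mulVec, dotProduct, Fin.sum_univ_three, Pi.zero_apply] at hai hbi
    ext j
    fin_cases j <;> simp [cross_apply] <;> grind
  choose c hc using key
  refine hN.ne_vecMulVec c (a ⨯₃ b) ?_
  ext i j
  rw [hc i]; rfl

lemma NoCommonRoot.cross_rows_ne_zero [IsAlgClosed k] {N : Matrix (Fin 3) (Fin 3) k}
    (hN : NoCommonRoot N) {v : Fin 3 → k} (hvN : v ᵥ* N = 0) {j : Fin 3} (hj : v j ≠ 0) :
    N (j + 1) ⨯₃ N (j + 2) ≠ 0 := by
  intro h
  have hrel : ∀ i, v j * N j i = -(v (j + 1) * N (j + 1) i + v (j + 2) * N (j + 2) i) := by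
    intro i
    have := congrFun hvN i
    simp only [vecMul, dotProduct, Fin.sum_univ_three, Pi.zero_apply] at this
    fin_cases j <;> simp <;> linear_combination this
  have main : ∃ r : Fin 3 → k, ∃ c₁ c₂ : k, N (j + 1) = c₁ • r ∧ N (j + 2) = c₂ • r := by
    by_cases h1 : N (j + 1) = 0
    · exact ⟨N (j + 2), 0, 1, by simp [h1], by simp⟩
    · obtain ⟨c, hc⟩ := eq_smul_of_cross_eq_zero h1 h
      exact ⟨N (j + 1), 1, c, by simp, hc⟩
  obtain ⟨r, c₁, c₂, h1, h2⟩ := main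
  have key : ∀ i, ∃ c : k, N i = c • r := by
    intro i
    have hi : i = j ∨ i = j + 1 ∨ i = j + 2 := by clear * -; revert i j; decide
    rcases hi with rfl | rfl | rfl
    · refine ⟨-(v (i + 1) * c₁ + v (i + 2) * c₂) / v i, ?_⟩
      ext l
      have := hrel l
      rw [h1, h2] at this
      simp at this ⊢
      field_simp
      linear_combination this
    · exact ⟨_, h1⟩
    · exact ⟨_, h2⟩
  choose c hc using key
  refine hN.ne_vecMulVec c r ?_
  ext i l
  rw [hc i]; rfl

end Pointwise

section Pencil

open Matrix Polynomial

variable {k : Type*} [Field k]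

/-- The pencil `B + T D` as a matrix of polynomials in one variable `T`. -/
def pencil (B D : Matrix (Fin 3) (Fin 3) k) : Matrix (Fin 3) (Fin 3) k[X] :=
  fun i j => Polynomial.C (B i j) + Polynomial.X * Polynomial.C (D i j)

lemma eval_vecMul_pencil (B D : Matrix (Fin 3) (Fin 3) k) (v : Fin 3 → k[X]) (t : k) (i : Fin 3) :
    ((v ᵥ* pencil B D) i).eval t = ((fun j => (v j).eval t) ᵥ* (B + t • D)) i := by
  simp [vecMul, dotProduct, pencil, Fin.sum_univ_three]
  ring

lemma coeff_succ_vecMul_pencil (B D : Matrix (Fin 3) (Fin 3) k) {v : Fin 3 → k[X]} {d : ℕ}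
    (hd : ∀ i, (v i).natDegree ≤ d) (i : Fin 3) :
    ((v ᵥ* pencil B D) i).coeff (d + 1) = ((fun j => (v j).coeff d) ᵥ* D) i := by
  have h : ∀ j, (v j).coeff (d + 1) = 0 := fun j =>
    coeff_eq_zero_of_natDegree_lt (Nat.lt_succ_of_le (hd j))
  simp [vecMul, dotProduct, pencil, Fin.sum_univ_three, mul_add, ← mul_assoc, h]

lemma exists_const_left_kernel [IsAlgClosed k] {B D : Matrix (Fin 3) (Fin 3) k}
    (hB : ∀ t : k, NoCommonRoot (B + t • D)) (hD : NoCommonRoot D) (d : ℕ) :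
    ∀ v : Fin 3 → k[X], v ≠ 0 → v ᵥ* pencil B D = 0 → (∀ i, (v i).natDegree ≤ d) →
      ∃ v₀ : Fin 3 → k, v₀ ≠ 0 ∧ v₀ ᵥ* B = 0 ∧ v₀ ᵥ* D = 0 := by
  induction d with
  | zero =>
    intro v hv h hd
    refine ⟨fun i => (v i).coeff 0, ?_, ?_, ?_⟩
    · contrapose! hv
      ext1 i
      rw [eq_C_of_natDegree_le_zero (hd i), congrFun hv i]; simp
    · ext i
      have := eval_vecMul_pencil B D v 0 i
      simpa [h, coeff_zero_eq_eval_zero] using this.symm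
    · ext i
      have := coeff_succ_vecMul_pencil B D hd i
      simpa [h] using this.symm
  | succ d ih =>
    intro v hv h hd
    by_cases htop : (fun i => (v i).coeff (d + 1)) = 0
    · refine ih v hv h fun i => ?_
      refine natDegree_le_iff_coeff_eq_zero.2 fun N hN => ?_
      rcases (Nat.succ_le_of_lt hN).eq_or_lt with rfl | hlt
      · exact congrFun htop i
      · exact coeff_eq_zero_of_natDegree_lt ((hd i).trans_lt hlt)
    · have hQ := hD.sq_ne_mul htop (by
        ext i; rw [← coeff_succ_vecMul_pencil B D hd i, h]; simp)
      have hcoef : (v 1 ^ 2 - v 0 * v 2).coeff ((d + 1) + (d + 1)) ≠ 0 := by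
        rwa [Polynomial.coeff_sub, pow_two, coeff_mul_add_eq_of_natDegree_le (hd 1) (hd 1),
          coeff_mul_add_eq_of_natDegree_le (hd 0) (hd 2), ← pow_two]
      have hdeg : (v 1 ^ 2 - v 0 * v 2).degree ≠ 0 := by
        intro h0
        rw [eq_C_of_degree_eq_zero h0, Polynomial.coeff_C] at hcoef
        simp at hcoef
      obtain ⟨t, ht⟩ := IsAlgClosed.exists_root _ hdeg
      have hvt : (fun i => (v i).eval t) = 0 := by
        by_contra hne
        refine (hB t).sq_ne_mul hne ?_ (by simpa using ht)
        ext i; rw [← eval_vecMul_pencil, h]; simp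
      choose w hw using fun i => dvd_iff_isRoot.2 (congrFun hvt i)
      have hvw : v = (Polynomial.X - Polynomial.C t) • w := by ext1 i; simpa using hw i
      have hX : (Polynomial.X - Polynomial.C t) ≠ 0 := X_sub_C_ne_zero t
      refine ih w ?_ ?_ ?_
      · rintro rfl; simp [hvw] at hv
      · rw [hvw, smul_vecMul] at h
        exact (smul_eq_zero.1 h).resolve_left hX
      · intro i
        by_cases hwi : w i = 0
        · simp [hwi]
        · have := hd i
          rw [hw i, natDegree_mul hX hwi, natDegree_X_sub_C] at this
          omega

lemma exists_const_left_kernel_of_det_eq_zero [IsAlgClosed k] {B D : Matrix (Fin 3) (Fin 3) k}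
    (hB : ∀ t : k, NoCommonRoot (B + t • D)) (hD : NoCommonRoot D) (hdet : (pencil B D).det = 0) :
    ∃ v₀ : Fin 3 → k, v₀ ≠ 0 ∧ v₀ ᵥ* B = 0 ∧ v₀ ᵥ* D = 0 := by
  obtain ⟨v, hv, h⟩ := exists_vecMul_eq_zero_iff.2 hdet
  exact exists_const_left_kernel hB hD (Finset.univ.sup fun i => (v i).natDegree) v hv h
    fun i => Finset.le_sup (f := fun i => (v i).natDegree) (Finset.mem_univ i)

lemma eval_det_pencil (B D : Matrix (Fin 3) (Fin 3) k) (t : k) :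
    (pencil B D).det.eval t = (B + t • D).det := by
  simp [det_fin_three, pencil]
  ring

lemma exists_combination_eq_one [IsAlgClosed k] (u : Fin 3 → k[X])
    (hu : ∀ t : k, (fun i => (u i).eval t) ≠ 0) : ∃ g : Fin 3 → k[X], g ⬝ᵥ u = 1 := by
  obtain ⟨d, hd⟩ := IsPrincipalIdealRing.principal (Ideal.span (Set.range u))
  have hdvd : ∀ i, d ∣ u i := fun i => by
    have : u i ∈ Ideal.span (Set.range u) := Ideal.subset_span ⟨i, rfl⟩
    rw [hd] at this
    exact Ideal.mem_span_singleton.1 this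
  have hd0 : d.degree = 0 := by
    by_contra hne
    obtain ⟨t, ht⟩ := IsAlgClosed.exists_root d hne
    refine hu t (funext fun i => ?_)
    exact ht.dvd (hdvd i)
  have htop : (1 : k[X]) ∈ Ideal.span (Set.range u) := by
    rw [hd]
    exact Ideal.mem_span_singleton.2 (isUnit_iff_degree_eq_zero.2 hd0).dvd
  obtain ⟨g, hg⟩ := (Ideal.mem_span_range_iff_exists_fun).1 htop
  exact ⟨g, hg⟩

lemma eq_smul_of_cross_eq_zero_of_combination {R : Type*} [CommRing R] {u f g : Fin 3 → R}
    (hg : g ⬝ᵥ u = 1) (h : u ⨯₃ f = 0) : f = (g ⬝ᵥ f) • u := by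
  have h0 := congrFun h 0
  have h1 := congrFun h 1
  have h2 := congrFun h 2
  simp [cross_apply] at h0 h1 h2
  simp only [dotProduct, Fin.sum_univ_three] at hg ⊢
  ext i
  fin_cases i <;> simp
  · linear_combination (-f 0) * hg + g 2 * h1 - g 1 * h2
  · linear_combination (-f 1) * hg + g 0 * h2 - g 2 * h0
  · linear_combination (-f 2) * hg + g 1 * h0 - g 0 * h1

/-- If a pencil has a constant left kernel vector, its right kernel is free on a vector of
degree two, with nonvanishing leading coefficient. -/
lemma exists_kernel_generator [IsAlgClosed k] {B D : Matrix (Fin 3) (Fin 3) k}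
    (hB : ∀ t : k, NoCommonRoot (B + t • D)) (hD : NoCommonRoot D)
    {v : Fin 3 → k} (hv : v ≠ 0) (hvB : v ᵥ* B = 0) (hvD : v ᵥ* D = 0) :
    ∃ u : Fin 3 → k[X], (∀ i, (u i).natDegree ≤ 2) ∧ (∃ i, (u i).coeff 2 ≠ 0) ∧
      pencil B D *ᵥ u = 0 ∧ ∀ f, pencil B D *ᵥ f = 0 → ∃ c : k[X], f = c • u := by
  obtain ⟨j, hj⟩ := Function.ne_iff.1 hv
  have hPv : ∀ i, ∑ l, Polynomial.C (v l) * pencil B D l i = 0 := by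
    intro i
    have h1 := congrArg Polynomial.C (congrFun hvB i)
    have h2 := congrArg Polynomial.C (congrFun hvD i)
    simp [vecMul, dotProduct, Fin.sum_univ_three] at h1 h2
    simp [pencil, Fin.sum_univ_three]
    linear_combination h1 + X * h2
  set u := pencil B D (j + 1) ⨯₃ pencil B D (j + 2) with hu
  have hdeg : ∀ i l, (pencil B D i l).natDegree ≤ 1 := by
    intro i l
    unfold pencil
    compute_degree
  have hc1 : ∀ i l, (pencil B D i l).coeff 1 = D i l := by
    intro i l
    simp [pencil]
  have hmul : ∀ i l i' l', (pencil B D i l * pencil B D i' l').natDegree ≤ 2 :=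
    fun i l i' l' => natDegree_mul_le_of_le (hdeg _ _) (hdeg _ _)
  have hcmul : ∀ i l i' l', (pencil B D i l * pencil B D i' l').coeff 2 = D i l * D i' l' := by
    intro i l i' l'
    rw [← hc1 i l, ← hc1 i' l']
    exact coeff_mul_add_eq_of_natDegree_le (hdeg _ _) (hdeg _ _)
  refine ⟨u, ?_, ?_, ?_, ?_⟩
  · intro i
    fin_cases i <;> simp [hu, cross_apply] <;>
      exact (natDegree_sub_le _ _).trans (max_le (hmul _ _ _ _) (hmul _ _ _ _))
  · have := hD.cross_rows_ne_zero hvD hj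
    obtain ⟨i, hi⟩ := Function.ne_iff.1 this
    refine ⟨i, ?_⟩
    convert hi using 1
    · fin_cases i <;> simp [hu, cross_apply, hcmul]
    · rfl
  · have e1 : pencil B D (j + 1) ⬝ᵥ u = 0 := dot_self_cross _ _
    have e2 : pencil B D (j + 2) ⬝ᵥ u = 0 := dot_cross_self _ _
    have e0 : pencil B D j ⬝ᵥ u = 0 := by
      have hne : Polynomial.C (v j) ≠ 0 := by simpa using hj
      refine (mul_eq_zero.1 ?_).resolve_left hne
      have a0 := hPv 0
      have a1 := hPv 1
      have a2 := hPv 2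
      simp only [dotProduct, Fin.sum_univ_three] at e1 e2 a0 a1 a2 ⊢
      fin_cases j <;> simp only [Fin.mk_zero, Fin.reduceFinMk, Fin.isValue,
        Fin.reduceAdd, Fin.mk_one, zero_add] at e1 e2 ⊢
      · linear_combination u 0 * a0 + u 1 * a1 + u 2 * a2 -
          Polynomial.C (v 1) * e1 - Polynomial.C (v 2) * e2
      · linear_combination u 0 * a0 + u 1 * a1 + u 2 * a2 -
          Polynomial.C (v 2) * e1 - Polynomial.C (v 0) * e2
      · linear_combination u 0 * a0 + u 1 * a1 + u 2 * a2 -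
          Polynomial.C (v 0) * e1 - Polynomial.C (v 1) * e2
    ext1 i
    have hi : i = j ∨ i = j + 1 ∨ i = j + 2 := by clear * -; revert i j; decide
    rcases hi with rfl | rfl | rfl
    exacts [e0, e1, e2]
  · intro f hf
    have hut : ∀ t : k, (fun i => (u i).eval t) ≠ 0 := by
      intro t
      have := (hB t).cross_rows_ne_zero (v := v) (by
        rw [vecMul_add, vecMul_smul, hvB, hvD]; simp) hj
      convert this using 1
      ext i
      fin_cases i <;> simp [hu, cross_apply, pencil] <;> ring
    obtain ⟨g, hg⟩ := exists_combination_eq_one u hut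
    refine ⟨_, eq_smul_of_cross_eq_zero_of_combination hg ?_⟩
    have e1 := congrFun hf (j + 1)
    have e2 := congrFun hf (j + 2)
    simp only [mulVec, dotProduct, Fin.sum_univ_three, Pi.zero_apply] at e1 e2
    ext1 i
    fin_cases i <;> simp [hu, cross_apply]
    · linear_combination pencil B D (j + 2) 0 * e1 - pencil B D (j + 1) 0 * e2
    · linear_combination pencil B D (j + 2) 1 * e1 - pencil B D (j + 1) 1 * e2
    · linear_combination pencil B D (j + 2) 2 * e1 - pencil B D (j + 1) 2 * e2

end Pencil

section Bigraded

open Matrix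

variable {k : Type*} [Field k]

lemma weight_bidegWt (e : Fin 4 →₀ ℕ) :
    Finsupp.weight bidegWt e = ((e 0 + e 1 : ℤ), (e 2 + e 3 : ℤ)) := by
  rw [Finsupp.weight_apply, Finsupp.sum_fintype _ _ (by simp)]
  ext <;> simp [Fin.sum_univ_four, bidegWt]

lemma monomial_eq_C_mul_pow (e : Fin 4 →₀ ℕ) (c : k) :
    monomial e c = C c * (X 0 ^ e 0 * X 1 ^ e 1 * X 2 ^ e 2 * X 3 ^ e 3) := by
  rw [monomial_eq, Finsupp.prod_fintype _ _ (by simp)]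
  simp [Fin.prod_univ_four]

lemma Bihom.induction {m n : ℤ} {P : Rk k → Prop} (hzero : P 0)
    (hadd : ∀ p q, P p → P q → P (p + q))
    (hmon : ∀ e : Fin 4 →₀ ℕ, ∀ c : k, (e 0 + e 1 : ℤ) = m → (e 2 + e 3 : ℤ) = n →
      P (monomial e c))
    {p : Rk k} (hp : Bihom p m n) : P p := by
  rw [p.as_sum]
  refine Finset.sum_induction _ P hadd hzero fun e he => ?_
  have := hp (mem_support_iff.1 he)
  rw [weight_bidegWt, Prod.mk.injEq] at this
  exact hmon e _ this.1 this.2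

/-- Homogenization of a one-variable polynomial to a form of degree `N` in `z, w`. -/
def binaryForm (N : ℕ) : Polynomial k →ₗ[k] Rk k where
  toFun f := ∑ j ∈ Finset.range (N + 1), C (f.coeff j) * (X 2 ^ j * X 3 ^ (N - j))
  map_add' f g := by simp [add_mul, Finset.sum_add_distrib]
  map_smul' c f := by simp [Finset.mul_sum, mul_assoc, MvPolynomial.smul_eq_C_mul]

lemma binaryForm_apply (N : ℕ) (f : Polynomial k) :
    binaryForm N f = ∑ j ∈ Finset.range (N + 1), C (f.coeff j) * (X 2 ^ j * X 3 ^ (N - j)) := rfl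

lemma bihom_binaryForm (N : ℕ) (f : Polynomial k) : Bihom (binaryForm N f) 0 N := by
  refine (weightedHomogeneousSubmodule k bidegWt _).sum_mem fun j hj => ?_
  have h : C (f.coeff j) * (X 2 ^ j * X 3 ^ (N - j)) =
      monomial (Finsupp.single 2 j + Finsupp.single 3 (N - j) : Fin 4 →₀ ℕ) (f.coeff j) := by
    rw [monomial_eq_C_mul_pow]; simp
  rw [h]
  refine isWeightedHomogeneous_monomial _ _ _ ?_
  rw [weight_bidegWt]
  have := Finset.mem_range.1 hj
  simp
  omega

lemma Bihom.exists_binaryForm {N : ℕ} {q : Rk k} (hq : Bihom q 0 N) :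
    ∃ f : Polynomial k, f.natDegree ≤ N ∧ binaryForm N f = q := by
  refine Bihom.induction (P := fun q => ∃ f : Polynomial k, f.natDegree ≤ N ∧ binaryForm N f = q)
    ⟨0, by simp, map_zero _⟩ ?_ ?_ hq
  · rintro _ _ ⟨f, hf, rfl⟩ ⟨g, hg, rfl⟩
    exact ⟨f + g, Polynomial.natDegree_add_le_of_degree_le hf hg, map_add _ _ _⟩
  · intro e c h1 h2
    have he0 : e 0 = 0 := by omega
    have he1 : e 1 = 0 := by omega
    have he3 : e 3 = N - e 2 := by omega
    refine ⟨Polynomial.monomial (e 2) c, (Polynomial.natDegree_monomial_le _).trans (by omega), ?_⟩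
    rw [binaryForm_apply, Finset.sum_eq_single (e 2), monomial_eq_C_mul_pow, he0, he1, he3]
    · simp
    · intro j _ hj
      simp [Polynomial.coeff_monomial, hj.symm]
    · intro h
      exact absurd (Finset.mem_range.2 (by omega)) h

/-- Restriction to the line `{(x, y)} × ℙ¹`, in the affine coordinate `z` with `w = 1`. -/
def dehom (x y : k) : Rk k →ₐ[k] Polynomial k :=
  aeval ![Polynomial.C x, Polynomial.C y, Polynomial.X, 1]

lemma dehom_binaryForm (x y : k) {N : ℕ} {f : Polynomial k} (hf : f.natDegree ≤ N) :
    dehom x y (binaryForm N f) = f := by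
  conv_rhs => rw [f.as_sum_range_C_mul_X_pow' (Nat.lt_succ_of_le hf)]
  simp [binaryForm_apply, dehom]

lemma Bihom.ext_dehom (x y : k) {N : ℕ} {p q : Rk k} (hp : Bihom p 0 N) (hq : Bihom q 0 N)
    (h : dehom x y p = dehom x y q) : p = q := by
  obtain ⟨f, hf, rfl⟩ := hp.exists_binaryForm
  obtain ⟨g, hg, rfl⟩ := hq.exists_binaryForm
  rw [dehom_binaryForm x y hf, dehom_binaryForm x y hg] at h
  rw [h]

lemma binaryForm_mul {N M : ℕ} {f g : Polynomial k} (hf : f.natDegree ≤ N)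
    (hg : g.natDegree ≤ M) : binaryForm N f * binaryForm M g = binaryForm (N + M) (f * g) := by
  refine Bihom.ext_dehom 0 0 ?_ (bihom_binaryForm _ _) ?_
  · have := IsWeightedHomogeneous.mul (bihom_binaryForm N f) (bihom_binaryForm M g)
    simpa [Bihom] using this
  · rw [map_mul, dehom_binaryForm _ _ hf, dehom_binaryForm _ _ hg,
      dehom_binaryForm _ _ (Polynomial.natDegree_mul_le_of_le hf hg)]

lemma binaryForm_linear (b d : k) :
    binaryForm 1 (Polynomial.C b + Polynomial.X * Polynomial.C d) = C d * X 2 + C b * X 3 := by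
  simp [binaryForm_apply, Finset.sum_range_succ]
  ring

lemma eval_binaryForm_one (x y z w : k) (f : Polynomial k) :
    eval ![x, y, z, w] (binaryForm 1 f) = f.coeff 0 * w + f.coeff 1 * z := by
  simp [binaryForm_apply, Finset.sum_range_succ]

/-- The form of bidegree `(2, 1)` whose coefficients at `x², xy, y²` are `d j z + b j w`. -/
def formTwoOne (b d : Fin 3 → k) : Rk k :=
  X 0 ^ 2 * (C (d 0) * X 2 + C (b 0) * X 3) + X 0 * X 1 * (C (d 1) * X 2 + C (b 1) * X 3) +
    X 1 ^ 2 * (C (d 2) * X 2 + C (b 2) * X 3)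

lemma Bihom.exists_formTwoOne {p : Rk k} (hp : Bihom p 2 1) :
    ∃ b d : Fin 3 → k, p = formTwoOne b d := by
  refine Bihom.induction (P := fun p => ∃ b d : Fin 3 → k, p = formTwoOne b d)
    ⟨0, 0, by simp [formTwoOne]⟩ ?_ ?_ hp
  · rintro _ _ ⟨b, d, rfl⟩ ⟨b', d', rfl⟩
    refine ⟨b + b', d + d', ?_⟩
    simp [formTwoOne]
    ring
  · intro e c h1 h2
    have hc : (e 0 = 2 ∧ e 1 = 0 ∨ e 0 = 1 ∧ e 1 = 1 ∨ e 0 = 0 ∧ e 1 = 2) ∧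
      (e 2 = 1 ∧ e 3 = 0 ∨ e 2 = 0 ∧ e 3 = 1) := by omega
    rw [monomial_eq_C_mul_pow]
    obtain ⟨⟨h0, h1⟩ | ⟨h0, h1⟩ | ⟨h0, h1⟩, ⟨h2, h3⟩ | ⟨h2, h3⟩⟩ := hc <;>
      rw [h0, h1, h2, h3]
    · exact ⟨0, ![c, 0, 0], by simp [formTwoOne]; ring⟩
    · exact ⟨![c, 0, 0], 0, by simp [formTwoOne]; ring⟩
    · exact ⟨0, ![0, c, 0], by simp [formTwoOne]; ring⟩
    · exact ⟨![0, c, 0], 0, by simp [formTwoOne]; ring⟩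
    · exact ⟨0, ![0, 0, c], by simp [formTwoOne]; ring⟩
    · exact ⟨![0, 0, c], 0, by simp [formTwoOne]; ring⟩

lemma eval_formTwoOne (b d : Fin 3 → k) (x y z w : k) :
    eval ![x, y, z, w] (formTwoOne b d) = ![x ^ 2, x * y, y ^ 2] ⬝ᵥ (w • b + z • d) := by
  simp [formTwoOne, dotProduct, Fin.sum_univ_three]
  ring

lemma dehom_formTwoOne (b d : Fin 3 → k) (x y : k) :
    dehom x y (formTwoOne b d) =
      Polynomial.C x ^ 2 * (Polynomial.C (b 0) + Polynomial.X * Polynomial.C (d 0)) +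
      Polynomial.C x * Polynomial.C y * (Polynomial.C (b 1) + Polynomial.X * Polynomial.C (d 1)) +
      Polynomial.C y ^ 2 * (Polynomial.C (b 2) + Polynomial.X * Polynomial.C (d 2)) := by
  simp [formTwoOne, dehom]
  ring

/-- The three forms of bidegree `(2, 1)` given by the columns of the pencil `B + T D`. -/
def columnForms (B D : Matrix (Fin 3) (Fin 3) k) (i : Fin 3) : Rk k :=
  formTwoOne (fun j => B j i) fun j => D j i

lemma sum_binaryForm_mul_columnForms_eq_zero_iff (B D : Matrix (Fin 3) (Fin 3) k) {N : ℕ}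
    {f : Fin 3 → Polynomial k} (hf : ∀ i, (f i).natDegree ≤ N) :
    ∑ i, binaryForm N (f i) * columnForms B D i = 0 ↔ pencil B D *ᵥ f = 0 := by
  constructor
  · intro h
    have key : ∀ x y : k, Polynomial.C x ^ 2 * (pencil B D *ᵥ f) 0 +
        Polynomial.C x * Polynomial.C y * (pencil B D *ᵥ f) 1 +
        Polynomial.C y ^ 2 * (pencil B D *ᵥ f) 2 = 0 := by
      intro x y
      have := congrArg (dehom x y) h
      rw [Fin.sum_univ_three] at this
      simp only [map_add, map_mul, dehom_binaryForm x y (hf _), columnForms, dehom_formTwoOne,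
        map_zero] at this
      simp only [mulVec, dotProduct, Fin.sum_univ_three, pencil]
      linear_combination this
    have h0 : (pencil B D *ᵥ f) 0 = 0 := by simpa using key 1 0
    have h2 : (pencil B D *ᵥ f) 2 = 0 := by simpa using key 0 1
    have h1 : (pencil B D *ᵥ f) 1 = 0 := by simpa [h0, h2] using key 1 1
    ext1 i
    fin_cases i
    exacts [h0, h1, h2]
  · intro h
    have hdeg : ∀ j i, (pencil B D j i).natDegree ≤ 1 := by
      intro j i
      unfold pencil
      compute_degree
    have hrow : ∀ j, ∑ i, binaryForm N (f i) * (C (D j i) * X 2 + C (B j i) * X 3) = 0 := by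
      intro j
      have := congrArg (binaryForm (N + 1)) (congrFun h j)
      simp only [mulVec, dotProduct, map_sum, Pi.zero_apply, map_zero] at this
      rw [← this]
      refine Finset.sum_congr rfl fun i _ => ?_
      rw [mul_comm (pencil B D j i), ← binaryForm_mul (hf i) (hdeg j i), ← binaryForm_linear]
      rfl
    have h0 := hrow 0
    have h1 := hrow 1
    have h2 := hrow 2
    simp only [Fin.sum_univ_three, columnForms, formTwoOne] at h0 h1 h2 ⊢
    linear_combination X 0 ^ 2 * h0 + X 0 * X 1 * h1 + X 1 ^ 2 * h2

lemma NoCommonZeros.noCommonRoot {B D : Matrix (Fin 3) (Fin 3) k}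
    (h : NoCommonZeros (columnForms B D 0) (columnForms B D 1) (columnForms B D 2))
    {z w : k} (hzw : (z, w) ≠ (0, 0)) : NoCommonRoot (w • B + z • D) := by
  intro x y hxy h0
  have key : ∀ i, eval ![x, y, z, w] (columnForms B D i) = 0 := by
    intro i
    rw [columnForms, eval_formTwoOne]
    exact congrFun h0 i
  rcases h x y z w hxy hzw with h | h | h <;> exact h (key _)

lemma mulVec_eq_zero_of_factor {B D : Matrix (Fin 3) (Fin 3) k} {a : Fin 3 → k} {q l : Rk k}
    (h : a 0 • columnForms B D 0 + a 1 • columnForms B D 1 + a 2 • columnForms B D 2 = q * l)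
    {z w : k} (hl : ∀ x y, eval ![x, y, z, w] l = 0) : (w • B + z • D) *ᵥ a = 0 := by
  have key : ∀ x y, ![x ^ 2, x * y, y ^ 2] ⬝ᵥ ((w • B + z • D) *ᵥ a) = 0 := by
    intro x y
    have := congrArg (eval ![x, y, z, w]) h
    simp only [map_add, map_mul, smul_eval, hl, mul_zero, columnForms, eval_formTwoOne] at this
    rw [← this]
    simp [dotProduct, mulVec, Fin.sum_univ_three]
    ring
  generalize (w • B + z • D) *ᵥ a = r at key
  have h0 : r 0 = 0 := by simpa [dotProduct, Fin.sum_univ_three] using key 1 0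
  have h2 : r 2 = 0 := by simpa [dotProduct, Fin.sum_univ_three] using key 0 1
  have h1 : r 1 = 0 := by simpa [dotProduct, Fin.sum_univ_three, h0, h2] using key 1 1
  ext i
  fin_cases i
  exacts [h0, h1, h2]

lemma NoCommonRoot.subsingleton_kernel [IsAlgClosed k] {N : Matrix (Fin 3) (Fin 3) k}
    (hN : NoCommonRoot N) :
    {P : Projectivization k (Fin 3 → k) | N *ᵥ P.rep = 0}.Subsingleton := by
  intro P hP Q hQ
  by_contra hne
  have hind := (Projectivization.independent_pair_iff_ne P Q).2 hne
  rw [Projectivization.independent_iff] at hind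
  refine crossProduct_ne_zero_iff_linearIndependent.2 ?_ (hN.cross_eq_zero_of_mulVec hP hQ)
  have hrep : Projectivization.rep ∘ ![P, Q] = ![P.rep, Q.rep] := by
    ext1 i
    fin_cases i <;> rfl
  rwa [hrep] at hind

lemma bidegGeneric_of_det_ne_zero [IsAlgClosed k] {B D : Matrix (Fin 3) (Fin 3) k}
    (hB : ∀ t : k, NoCommonRoot (B + t • D)) (hD : NoCommonRoot D)
    (hdet : (pencil B D).det ≠ 0) :
    BidegGeneric (columnForms B D 0) (columnForms B D 1) (columnForms B D 2) := by
  classical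
  refine Set.Finite.subset (hD.subsingleton_kernel.finite.union
    (Set.Finite.biUnion (pencil B D).det.roots.toFinset.finite_toSet
      fun t _ => (hB t).subsingleton_kernel.finite)) ?_
  rintro P ⟨q, l, -, hl, h⟩
  obtain ⟨f, hf, rfl⟩ := Bihom.exists_binaryForm (N := 1) (by simpa using hl)
  by_cases hf1 : f.coeff 1 = 0
  · left
    have := mulVec_eq_zero_of_factor (z := 1) (w := 0) h
      (by intro x y; rw [eval_binaryForm_one, hf1]; simp)
    simpa using this
  · right
    have hker := mulVec_eq_zero_of_factor (z := -f.coeff 0 / f.coeff 1) (w := 1) h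
      (by intro x y; rw [eval_binaryForm_one]; field_simp; ring)
    rw [one_smul] at hker
    refine Set.mem_biUnion (x := -f.coeff 0 / f.coeff 1) ?_ hker
    simp only [Finset.mem_coe, Multiset.mem_toFinset, Polynomial.mem_roots hdet,
      Polynomial.IsRoot.def, eval_det_pencil]
    exact exists_mulVec_eq_zero_iff.1 ⟨_, P.rep_nonzero, hker⟩

lemma mem_syzPiece_two_iff {B D : Matrix (Fin 3) (Fin 3) k} {N : ℕ} {A : Fin 3 → Rk k} :
    A ∈ SyzPiece (columnForms B D) 2 (N + 1) ↔
      ∃ f : Fin 3 → Polynomial k, (∀ i, (f i).natDegree ≤ N) ∧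
        (A = fun i => binaryForm N (f i)) ∧ pencil B D *ᵥ f = 0 := by
  have hmap : syzMapk (columnForms B D) A = ∑ i, A i * columnForms B D i := by
    simp [syzMapk]
  have hmem : A ∈ SyzPiece (columnForms B D) 2 (N + 1) ↔
      (∀ i, Bihom (A i) 0 N) ∧ ∑ i, A i * columnForms B D i = 0 := by
    simp [SyzPiece, Submodule.mem_pi, hmap, Bihom]
  rw [hmem]
  constructor
  · rintro ⟨hA, hsum⟩
    choose f hf hfA using fun i => (hA i).exists_binaryForm
    obtain rfl : A = fun i => binaryForm N (f i) := funext fun i => (hfA i).symm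
    exact ⟨f, hf, rfl, (sum_binaryForm_mul_columnForms_eq_zero_iff B D hf).1 hsum⟩
  · rintro ⟨f, hf, rfl, h⟩
    exact ⟨fun i => bihom_binaryForm _ _, (sum_binaryForm_mul_columnForms_eq_zero_iff B D hf).2 h⟩

/-- The syzygies of bidegree `(2, m + 3)` are the multiples, by forms of degree `m` in `z, w`, of
a generator of degree two of the kernel of the pencil. -/
lemma finrank_syzPiece_two {B D : Matrix (Fin 3) (Fin 3) k} {u : Fin 3 → Polynomial k}
    (hdeg : ∀ i, (u i).natDegree ≤ 2) {i₀ : Fin 3} (hi₀ : (u i₀).coeff 2 ≠ 0)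
    (hu : pencil B D *ᵥ u = 0)
    (hgen : ∀ f, pencil B D *ᵥ f = 0 → ∃ c : Polynomial k, f = c • u) (m : ℕ) :
    Module.finrank k (SyzPiece (columnForms B D) 2 ((m + 2 : ℕ) + 1)) = m + 1 := by
  let L : Polynomial k →ₗ[k] (Fin 3 → Rk k) :=
    LinearMap.pi fun i => (binaryForm (m + 2)).comp (LinearMap.mulRight k (u i))
  have hL : ∀ c, L c = fun i => binaryForm (m + 2) (c * u i) := fun c => rfl
  have hu0 : u i₀ ≠ 0 := by
    rintro h
    simp [h] at hi₀
  have hmem : ∀ c : Polynomial k, c ∈ Polynomial.degreeLT k (m + 1) ↔ c.natDegree ≤ m := by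
    intro c
    rw [Polynomial.degreeLT_succ_eq_degreeLE, Polynomial.mem_degreeLE,
      Polynomial.natDegree_le_iff_degree_le]
  have hcu : ∀ c : Polynomial k, c.natDegree ≤ m → ∀ i, (c * u i).natDegree ≤ m + 2 :=
    fun c hc i => Polynomial.natDegree_mul_le_of_le hc (hdeg i)
  have hrange : SyzPiece (columnForms B D) 2 ((m + 2 : ℕ) + 1) =
      LinearMap.range (L.domRestrict (Polynomial.degreeLT k (m + 1))) := by
    ext A
    rw [mem_syzPiece_two_iff, LinearMap.mem_range]
    constructor
    · rintro ⟨f, hf, rfl, h⟩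
      obtain ⟨c, rfl⟩ := hgen f h
      refine ⟨⟨c, (hmem c).2 ?_⟩, rfl⟩
      by_cases hc : c = 0
      · simp [hc]
      · have h1 := hf i₀
        have h2 := Polynomial.le_natDegree_of_ne_zero hi₀
        rw [Pi.smul_apply, smul_eq_mul, Polynomial.natDegree_mul hc hu0] at h1
        omega
    · rintro ⟨⟨c, hc⟩, rfl⟩
      exact ⟨c • u, hcu c ((hmem c).1 hc), rfl, by rw [mulVec_smul, hu, smul_zero]⟩
  have hinj : Function.Injective (L.domRestrict (Polynomial.degreeLT k (m + 1))) := by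
    rw [← LinearMap.ker_eq_bot, LinearMap.ker_eq_bot']
    rintro ⟨c, hc⟩ h
    have h1 := congrArg (dehom 0 0) (congrFun h i₀)
    rw [LinearMap.domRestrict_apply, hL, Pi.zero_apply, map_zero,
      dehom_binaryForm 0 0 (hcu c ((hmem c).1 hc) i₀)] at h1
    exact Subtype.ext ((mul_eq_zero.1 h1).resolve_right hu0)
  rw [hrange, LinearMap.finrank_range_of_inj hinj,
    (Polynomial.degreeLTEquiv k (m + 1)).finrank_eq, Module.finrank_fin_fun]

end Bigraded

/-- In the non-generic case, `dim_k Syz(p)_{2,n} = n − 2` for all `n ≥ 3`. -/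
theorem statement6 {k : Type*} [Field k] [IsAlgClosed k] (p0 p1 p2 : Rk k)
    (h0 : Bihom p0 2 1) (h1 : Bihom p1 2 1) (h2 : Bihom p2 2 1)
    (hncz : NoCommonZeros p0 p1 p2) (hgen : ¬ BidegGeneric p0 p1 p2) :
    ∀ n : ℤ, 3 ≤ n →
      (Module.finrank k (SyzPiece ![p0, p1, p2] 2 n) : ℤ) = n - 2 := by
  intro n hn
  obtain ⟨b0, d0, rfl⟩ := h0.exists_formTwoOne
  obtain ⟨b1, d1, rfl⟩ := h1.exists_formTwoOne
  obtain ⟨b2, d2, rfl⟩ := h2.exists_formTwoOne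
  let B : Matrix (Fin 3) (Fin 3) k := fun j i => ![b0, b1, b2] i j
  let D : Matrix (Fin 3) (Fin 3) k := fun j i => ![d0, d1, d2] i j
  have hcol0 : formTwoOne b0 d0 = columnForms B D 0 := rfl
  have hcol1 : formTwoOne b1 d1 = columnForms B D 1 := rfl
  have hcol2 : formTwoOne b2 d2 = columnForms B D 2 := rfl
  clear_value B D
  rw [hcol0, hcol1, hcol2] at hncz hgen ⊢
  have hcol : ![columnForms B D 0, columnForms B D 1, columnForms B D 2] = columnForms B D := by
    ext1 i
    fin_cases i <;> rfl
  have hB : ∀ t : k, NoCommonRoot (B + t • D) := fun t => by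
    simpa using hncz.noCommonRoot (z := t) (w := 1) (by simp)
  have hD : NoCommonRoot D := by
    simpa using hncz.noCommonRoot (z := 1) (w := 0) (by simp)
  have hdet : (pencil B D).det = 0 := by
    by_contra hdet
    exact hgen (bidegGeneric_of_det_ne_zero hB hD hdet)
  obtain ⟨v, hv, hvB, hvD⟩ := exists_const_left_kernel_of_det_eq_zero hB hD hdet
  obtain ⟨u, hdeg, ⟨i₀, hi₀⟩, hu, hker⟩ := exists_kernel_generator hB hD hv hvB hvD
  obtain ⟨m, rfl⟩ : ∃ m : ℕ, n = ((m + 2 : ℕ) : ℤ) + 1 := ⟨(n - 3).toNat, by omega⟩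
  rw [hcol, finrank_syzPiece_two hdeg hi₀ hu hker m]
  push_cast
  ring
end
end

section
/- Let p0, p1, p2 ∈ R_{2,1} have no common zeros on P^1 × P^1 and be generic. Then Syz(p) has six minimal generators: one of bidegree (6,1), three of bidegree (4,2), and two of bidegree (3,3). Precisely, there exist s ∈ Syz(p)_{6,1} and t1, t2 ∈ Syz(p)_{3,3} such that s, the three Koszul syzygies (which lie in Syz(p)_{4,2}), t1, and t2 generate Syz(p) as an R-module; moreover Syz(p) cannot be generated by fewer than six elements. -/
open MvPolynomial

noncomputable section

namespace BidegSyz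

variable {k : Type*} [Field k]

/-- The weight recording the degree in `z, w` only. -/
def zwWt : Fin 4 → ℕ := ![0, 0, 1, 1]

/-- Homogeneity in the variables `z, w`. -/
abbrev ZWHom (f : Rk k) (n : ℕ) : Prop := f.IsWeightedHomogeneous zwWt n

/-- Substitution of constants for `z, w`. -/
def specZW (c d : k) : Rk k →ₐ[k] Rk k := aeval ![X 0, X 1, C c, C d]

@[simp] lemma specZW_X0 (c d : k) : specZW c d (X 0) = X 0 := by simp [specZW]
@[simp] lemma specZW_X1 (c d : k) : specZW c d (X 1) = X 1 := by simp [specZW]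
@[simp] lemma specZW_X2 (c d : k) : specZW c d (X 2) = C c := by simp [specZW]
@[simp] lemma specZW_X3 (c d : k) : specZW c d (X 3) = C d := by simp [specZW]
@[simp] lemma specZW_C (c d a : k) : specZW c d (C a) = C a := by simp [specZW]

lemma weight_zw (d : Fin 4 →₀ ℕ) : Finsupp.weight zwWt d = d 2 + d 3 := by
  simp [Finsupp.weight_apply, Finsupp.sum_fintype, Fin.sum_univ_four, zwWt]

lemma weight_bideg (d : Fin 4 →₀ ℕ) :
    Finsupp.weight bidegWt d = ((d 0 + d 1 : ℤ), (d 2 + d 3 : ℤ)) := by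
  simp [Finsupp.weight_apply, Finsupp.sum_fintype, Fin.sum_univ_four, bidegWt, Prod.ext_iff]

lemma _root_.Bihom.zwHom {f : Rk k} {m : ℤ} {n : ℕ} (h : Bihom f m n) : ZWHom f n := by
  intro d hd
  have := h hd
  rw [weight_bideg, Prod.mk.injEq] at this
  rw [weight_zw]
  exact_mod_cast this.2

lemma zwHom_X0 : ZWHom (X 0 : Rk k) 0 := isWeightedHomogeneous_X k zwWt 0
lemma zwHom_X1 : ZWHom (X 1 : Rk k) 0 := isWeightedHomogeneous_X k zwWt 1
lemma zwHom_X2 : ZWHom (X 2 : Rk k) 1 := isWeightedHomogeneous_X k zwWt 2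
lemma zwHom_X3 : ZWHom (X 3 : Rk k) 1 := isWeightedHomogeneous_X k zwWt 3

lemma monomial_four (d : Fin 4 →₀ ℕ) (a : k) :
    monomial d a = C a * (X 0 ^ d 0 * X 1 ^ d 1 * X 2 ^ d 2 * X 3 ^ d 3 : Rk k) := by
  rw [monomial_eq, Finsupp.prod_fintype _ _ (by simp), Fin.prod_univ_four]

lemma specZW_of_zwHom_zero {f : Rk k} (hf : ZWHom f 0) (c d : k) : specZW c d f = f := by
  rw [f.as_sum, map_sum]
  refine Finset.sum_congr rfl fun e he => ?_
  have := hf (mem_support_iff.1 he)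
  rw [weight_zw] at this
  have h2 : e 2 = 0 := by omega
  have h3 : e 3 = 0 := by omega
  simp [monomial_four, h2, h3]

lemma zwHom_specZW (f : Rk k) (c d : k) : ZWHom (specZW c d f) 0 := by
  induction f using MvPolynomial.induction_on with
  | C a => simpa using isWeightedHomogeneous_C zwWt a
  | add p q hp hq => simpa using hp.add hq
  | mul_X p i hp =>
    have hX : ZWHom (specZW c d (X i)) 0 := by
      fin_cases i
      · simpa using zwHom_X0
      · simpa using zwHom_X1
      · simpa using isWeightedHomogeneous_C zwWt c
      · simpa using isWeightedHomogeneous_C zwWt d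
    simpa using hp.mul hX

lemma exists_zw_decomp {f : Rk k} {n : ℕ} (hf : ZWHom f (n + 1)) :
    ∃ g h : Rk k, ZWHom g n ∧ ZWHom h n ∧ f = X 2 * g + X 3 * h := by
  let S : Submodule k (Rk k) :=
    (weightedHomogeneousSubmodule k zwWt n).map (LinearMap.mulLeft k (X 2)) ⊔
      (weightedHomogeneousSubmodule k zwWt n).map (LinearMap.mulLeft k (X 3))
  suffices h : f ∈ S by
    obtain ⟨_, ⟨g, hg, rfl⟩, _, ⟨h, hh, rfl⟩, e⟩ := Submodule.mem_sup.1 h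
    exact ⟨g, h, hg, hh, by simpa using e.symm⟩
  rw [f.as_sum]
  refine sum_mem fun e he => ?_
  have hw := hf (mem_support_iff.1 he)
  rw [weight_zw] at hw
  have key : ∀ i : Fin 4, e i ≠ 0 →
      X i * monomial (e - Finsupp.single i 1) (coeff e f) = monomial e (coeff e f) := by
    intro i hi
    rw [X, monomial_mul, one_mul, add_tsub_cancel_of_le]
    exact Finsupp.single_le_iff.2 (Nat.one_le_iff_ne_zero.2 hi)
  by_cases h2 : e 2 = 0
  · refine Submodule.mem_sup_right ⟨monomial (e - Finsupp.single 3 1) (coeff e f), ?_, key 3 (by omega)⟩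
    refine isWeightedHomogeneous_monomial _ _ _ ?_
    rw [weight_zw]
    simp
    omega
  · refine Submodule.mem_sup_left ⟨monomial (e - Finsupp.single 2 1) (coeff e f), ?_, key 2 h2⟩
    refine isWeightedHomogeneous_monomial _ _ _ ?_
    rw [weight_zw]
    simp
    omega

lemma exists_spec_decomp (c : k) : ∀ {n : ℕ} {f : Rk k}, ZWHom f (n + 1) →
    ∃ g, ZWHom g n ∧ f = X 3 ^ (n + 1) * specZW c 1 f + (X 2 - C c * X 3) * g
  | 0, f, hf => by
    obtain ⟨g, h, hg, hh, rfl⟩ := exists_zw_decomp hf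
    refine ⟨g, hg, ?_⟩
    simp only [map_add, map_mul, specZW_X2, specZW_X3, specZW_of_zwHom_zero hg,
      specZW_of_zwHom_zero hh, C_1]
    ring
  | n + 1, f, hf => by
    obtain ⟨g, h, hg, hh, rfl⟩ := exists_zw_decomp hf
    obtain ⟨q, hq, e⟩ := exists_spec_decomp c ((hg.C_mul c).add hh)
    have hq' : ZWHom (X 3 * q) (n + 1) := by simpa only [add_comm] using zwHom_X3.mul hq
    refine ⟨X 3 * q + g, hq'.add hg, ?_⟩
    simp only [map_add, map_mul, specZW_X2, specZW_X3, specZW_C, C_1] at e ⊢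
    linear_combination X 3 * e

lemma eq_zero_of_zw_one {f g : Rk k} (hf : ZWHom f 0) (hg : ZWHom g 0)
    (h : X 2 * f + X 3 * g = 0) : f = 0 ∧ g = 0 := by
  have h1 := congrArg (specZW 1 0) h
  have h2 := congrArg (specZW 0 1) h
  simp [specZW_of_zwHom_zero hf, specZW_of_zwHom_zero hg] at h1 h2
  exact ⟨h1, h2⟩

lemma eq_zero_of_zw_two {f g h : Rk k} (hf : ZWHom f 0) (hg : ZWHom g 0) (hh : ZWHom h 0)
    (e : X 2 ^ 2 * f + X 2 * X 3 * g + X 3 ^ 2 * h = 0) : f = 0 ∧ g = 0 ∧ h = 0 := by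
  have h1 := congrArg (specZW 1 0) e
  have h2 := congrArg (specZW 0 1) e
  have h3 := congrArg (specZW 1 1) e
  simp [specZW_of_zwHom_zero hf, specZW_of_zwHom_zero hg, specZW_of_zwHom_zero hh] at h1 h2 h3
  simp_all

/-- The binary quadratic form with coefficients `q`. -/
def quad (q : Fin 3 → k) : Rk k := C (q 0) * X 0 ^ 2 + C (q 1) * (X 0 * X 1) + C (q 2) * X 1 ^ 2

lemma bihom_C (a : k) : Bihom (C a : Rk k) 0 0 := isWeightedHomogeneous_C bidegWt a
lemma bihom_X0 : Bihom (X 0 : Rk k) 1 0 := isWeightedHomogeneous_X k bidegWt 0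
lemma bihom_X1 : Bihom (X 1 : Rk k) 1 0 := isWeightedHomogeneous_X k bidegWt 1
lemma bihom_X2 : Bihom (X 2 : Rk k) 0 1 := isWeightedHomogeneous_X k bidegWt 2
lemma bihom_X3 : Bihom (X 3 : Rk k) 0 1 := isWeightedHomogeneous_X k bidegWt 3

lemma _root_.Bihom.mul' {f g : Rk k} {m n m' n' : ℤ} (hf : Bihom f m n) (hg : Bihom g m' n') :
    Bihom (f * g) (m + m') (n + n') := IsWeightedHomogeneous.mul hf hg

lemma bihom_quad (q : Fin 3 → k) : Bihom (quad q) 2 0 := by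
  unfold quad
  refine ((IsWeightedHomogeneous.C_mul ?_ _).add (IsWeightedHomogeneous.C_mul ?_ _)).add
    (IsWeightedHomogeneous.C_mul ?_ _)
  · rw [sq]; exact bihom_X0.mul' bihom_X0
  · exact bihom_X0.mul' bihom_X1
  · rw [sq]; exact bihom_X1.mul' bihom_X1

lemma exists_quad_decomp {p : Rk k} (hp : Bihom p 2 1) :
    ∃ a b : Fin 3 → k, p = X 2 * quad a + X 3 * quad b := by
  let φ : (Fin 3 → k) × (Fin 3 → k) →ₗ[k] Rk k :=
    { toFun := fun ab => X 2 * quad ab.1 + X 3 * quad ab.2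
      map_add' := by intros; simp [quad]; ring
      map_smul' := by intros; simp [quad, smul_eq_C_mul]; ring }
  suffices h : p ∈ LinearMap.range φ by
    obtain ⟨⟨a, b⟩, e⟩ := h
    exact ⟨a, b, e.symm⟩
  rw [p.as_sum]
  refine sum_mem fun e he => ?_
  have hw := hp (mem_support_iff.1 he)
  rw [weight_bideg, Prod.mk.injEq] at hw
  obtain ⟨hw1, hw2⟩ := hw
  rw [monomial_four]
  have h1 : (e 0 = 2 ∧ e 1 = 0) ∨ (e 0 = 1 ∧ e 1 = 1) ∨ (e 0 = 0 ∧ e 1 = 2) := by omega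
  have h2 : (e 2 = 1 ∧ e 3 = 0) ∨ (e 2 = 0 ∧ e 3 = 1) := by omega
  generalize coeff e p = a
  rcases h1 with ⟨h0, h1⟩ | ⟨h0, h1⟩ | ⟨h0, h1⟩ <;> rcases h2 with ⟨h2, h3⟩ | ⟨h2, h3⟩ <;>
    simp only [h0, h1, h2, h3]
  · exact ⟨(![a, 0, 0], 0), by simp [φ, quad]; ring⟩
  · exact ⟨(0, ![a, 0, 0]), by simp [φ, quad]; ring⟩
  · exact ⟨(![0, a, 0], 0), by simp [φ, quad]; ring⟩
  · exact ⟨(0, ![0, a, 0]), by simp [φ, quad]; ring⟩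
  · exact ⟨(![0, 0, a], 0), by simp [φ, quad]; ring⟩
  · exact ⟨(0, ![0, 0, a]), by simp [φ, quad]; ring⟩

/-- The forms `z * quad (α i) + w * quad (β i)` of bidegree `(2, 1)`. -/
def pencil (α β : Fin 3 → Fin 3 → k) (i : Fin 3) : Rk k := X 2 * quad (α i) + X 3 * quad (β i)

/-- The cross product of the coefficient vectors of `z` and `w` in `pencil α β`. -/
def minors (α β : Fin 3 → Fin 3 → k) : Fin 3 → Rk k :=
  ![quad (α 1) * quad (β 2) - quad (α 2) * quad (β 1),
    quad (α 2) * quad (β 0) - quad (α 0) * quad (β 2),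
    quad (α 0) * quad (β 1) - quad (α 1) * quad (β 0)]

lemma bihom_minors (α β : Fin 3 → Fin 3 → k) (i : Fin 3) : Bihom (minors α β i) 4 0 := by
  have h (a b : Fin 3 → k) : Bihom (quad a * quad b) 4 0 := (bihom_quad a).mul' (bihom_quad b)
  fin_cases i
  · exact (h _ _).sub (h _ _)
  · exact (h _ _).sub (h _ _)
  · exact (h _ _).sub (h _ _)

lemma exists_dependent {u v : Fin 3 → k} (h : crossProduct u v = 0) :
    ∃ c d : k, (c, d) ≠ (0, 0) ∧ ∀ i, c * u i + d * v i = 0 := by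
  have h' : ¬ LinearIndependent k ![u, v] := fun hl =>
    crossProduct_ne_zero_iff_linearIndependent.2 hl h
  rw [LinearIndependent.pair_iff] at h'
  push Not at h'
  obtain ⟨c, d, e, hcd⟩ := h'
  refine ⟨c, d, fun h0 => ?_, fun i => by simpa using congrFun e i⟩
  rw [Prod.mk.injEq] at h0
  exact hcd h0.1 h0.2

lemma X_pow_mem_span_minors [IsAlgClosed k] {α β : Fin 3 → Fin 3 → k}
    (h : NoCommonZeros (pencil α β 0) (pencil α β 1) (pencil α β 2)) :
    ∃ N : ℕ, (X 0 : Rk k) ^ N ∈ Ideal.span (Set.range (minors α β)) ∧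
      (X 1 : Rk k) ^ N ∈ Ideal.span (Set.range (minors α β)) := by
  set I := Ideal.span (Set.range (minors α β))
  have hz : ∀ x ∈ zeroLocus k I, x 0 = 0 ∧ x 1 = 0 := by
    intro x hx
    by_contra hne
    have hs (i : Fin 3) : eval x (minors α β i) = 0 := by
      simpa [aeval_eq_eval] using hx _ (Ideal.subset_span ⟨i, rfl⟩)
    obtain ⟨c, d, hcd, e⟩ := exists_dependent
      (u := fun i => eval x (quad (α i))) (v := fun i => eval x (quad (β i))) (by
        have h0 := hs 0
        have h1 := hs 1
        have h2 := hs 2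
        simp only [minors, Matrix.cons_val, map_sub, map_mul] at h0 h1 h2
        rw [cross_apply, h0, h1, h2]
        ext i; fin_cases i <;> rfl)
    have key (i : Fin 3) : eval ![x 0, x 1, c, d] (pencil α β i) = 0 := by
      simpa [pencil, quad] using e i
    have := h (x 0) (x 1) c d (by rwa [ne_eq, Prod.mk.injEq]) hcd
    simp [key] at this
  have hrad : ∀ i : Fin 4, (∀ x ∈ zeroLocus k I, x i = 0) → (X i : Rk k) ∈ I.radical := by
    intro i hi
    rw [← vanishingIdeal_zeroLocus_eq_radical (K := k), mem_vanishingIdeal_iff]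
    intro x hx
    simpa using hi x hx
  obtain ⟨n, hn⟩ := hrad 0 fun x hx => (hz x hx).1
  obtain ⟨m, hm⟩ := hrad 1 fun x hx => (hz x hx).2
  exact ⟨max n m, I.pow_mem_of_pow_mem hn (le_max_left _ _),
    I.pow_mem_of_pow_mem hm (le_max_right _ _)⟩

lemma isRelPrime_X_pow (N : ℕ) : IsRelPrime ((X 0 : Rk k) ^ N) (X 1 ^ N) := by
  refine IsRelPrime.pow ?_
  rw [(X_prime (R := k) (i := (0 : Fin 4))).irreducible.isRelPrime_iff_not_dvd, X_dvd_X]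
  simp

/-- A vector proportional to one whose entries generate powers of `x` and `y` is a multiple of it. -/
lemma exists_eq_mul {s B : Fin 3 → Rk k} {N : ℕ} (hx : (X 0 : Rk k) ^ N ∈ Ideal.span (Set.range s))
    (hy : (X 1 : Rk k) ^ N ∈ Ideal.span (Set.range s)) (hB : ∀ i j, B i * s j = B j * s i) :
    ∃ c, ∀ i, B i = s i * c := by
  obtain ⟨h, hh⟩ := Ideal.mem_span_range_iff_exists_fun.1 hx
  obtain ⟨h', hh'⟩ := Ideal.mem_span_range_iff_exists_fun.1 hy
  have e (j : Fin 3) : X 0 ^ N * B j = s j * ∑ i, h i * B i := by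
    rw [← hh, Finset.sum_mul, Finset.mul_sum]
    exact Finset.sum_congr rfl fun i _ => by linear_combination h i * hB j i
  have e' (j : Fin 3) : X 1 ^ N * B j = s j * ∑ i, h' i * B i := by
    rw [← hh', Finset.sum_mul, Finset.mul_sum]
    exact Finset.sum_congr rfl fun i _ => by linear_combination h' i * hB j i
  have hd : X 1 ^ N * (∑ i, h i * B i) = X 0 ^ N * ∑ i, h' i * B i := by
    rw [← hh, Finset.mul_sum, Finset.sum_mul]
    exact Finset.sum_congr rfl fun i _ => by linear_combination h i * e' i
  obtain ⟨c, hc⟩ := (isRelPrime_X_pow N).dvd_of_dvd_mul_left (Dvd.intro _ hd.symm)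
  refine ⟨c, fun i => mul_left_cancel₀ (pow_ne_zero N (X_ne_zero (0 : Fin 4))) ?_⟩
  rw [e, hc]
  ring

lemma exists_ne_zero_of_X_pow_mem {s : Fin 3 → Rk k} {N : ℕ}
    (hx : (X 0 : Rk k) ^ N ∈ Ideal.span (Set.range s)) : ∃ i, s i ≠ 0 := by
  by_contra! h
  obtain ⟨c, hc⟩ := Ideal.mem_span_range_iff_exists_fun.1 hx
  simp only [h, mul_zero, Finset.sum_const_zero] at hc
  exact pow_ne_zero N (X_ne_zero (0 : Fin 4)) hc.symm

/-- The three entries of a pencil without base points are linearly independent. -/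
lemma eq_zero_of_sum_pencil [IsAlgClosed k] {α β : Fin 3 → Fin 3 → k}
    (h : NoCommonZeros (pencil α β 0) (pencil α β 1) (pencil α β 2)) {a : Fin 3 → k}
    (ha : ∑ i, C (a i) * pencil α β i = 0) : a = 0 := by
  obtain ⟨N, hx, hy⟩ := X_pow_mem_span_minors h
  by_contra hne
  obtain ⟨i, hi⟩ := Function.ne_iff.1 hne
  have huv : (∑ i, C (a i) * quad (α i) : Rk k) = 0 ∧ (∑ i, C (a i) * quad (β i) : Rk k) = 0 := by
    refine eq_zero_of_zw_one ?_ ?_ ?_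
    · exact IsWeightedHomogeneous.sum _ _ _ fun i _ => ((bihom_quad _).zwHom (n := 0)).C_mul _
    · exact IsWeightedHomogeneous.sum _ _ _ fun i _ => ((bihom_quad _).zwHom (n := 0)).C_mul _
    · rw [← ha]
      simp only [pencil, Fin.sum_univ_three]
      ring
  obtain ⟨hu, hv⟩ := huv
  rw [Fin.sum_univ_three] at hu hv
  have hdvd (j : Fin 3) : minors α β i ∣ minors α β j := by
    have hprop : C (a i) * minors α β j = C (a j) * minors α β i := by
      fin_cases i <;> fin_cases j <;> simp [minors] <;> grind
    refine ⟨C ((a i)⁻¹ * a j), ?_⟩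
    have : (C ((a i)⁻¹) * C (a i) : Rk k) = 1 := by
      rw [← C_mul, inv_mul_cancel₀ hi, C_1]
    rw [C_mul]
    linear_combination C (a i)⁻¹ * hprop - minors α β j * this
  have hle : Ideal.span (Set.range (minors α β)) ≤ Ideal.span {minors α β i} := by
    rw [Ideal.span_le]
    rintro _ ⟨j, rfl⟩
    exact Ideal.mem_span_singleton.2 (hdvd j)
  have hu := isRelPrime_X_pow N (Ideal.mem_span_singleton.1 (hle hx))
    (Ideal.mem_span_singleton.1 (hle hy))
  have := hu.map (constantCoeff (σ := Fin 4) (R := k))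
  fin_cases i <;> simp [minors, quad] at this

/-- `Pᵢⱼ = αᵢⱼ z + βᵢⱼ w`, the matrix of `pencil α β` with respect to `x², xy, y²`. -/
def pencilMatrix (α β : Fin 3 → Fin 3 → k) : Matrix (Fin 3) (Fin 3) (Rk k) :=
  .of fun i j => X 2 * C (α i j) + X 3 * C (β i j)

open Matrix in
/-- The first syzygy of bidegree `(3, 3)`. -/
def syzOne (α β : Fin 3 → Fin 3 → k) : Fin 3 → Rk k :=
  ![X 1, -X 0, 0] ᵥ* (pencilMatrix α β).adjugate

open Matrix in
/-- The second syzygy of bidegree `(3, 3)`. -/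
def syzTwo (α β : Fin 3 → Fin 3 → k) : Fin 3 → Rk k :=
  ![0, X 1, -X 0] ᵥ* (pencilMatrix α β).adjugate

open Matrix in
lemma pencilMatrix_mulVec (α β : Fin 3 → Fin 3 → k) :
    pencilMatrix α β *ᵥ ![X 0 ^ 2, X 0 * X 1, X 1 ^ 2] = pencil α β := by
  ext1 i
  simp only [pencilMatrix, mulVec, dotProduct, Fin.sum_univ_three, of_apply, pencil, quad, cons_val]
  ring

open Matrix in
lemma vecMul_adjugate_dotProduct (α β : Fin 3 → Fin 3 → k) (a : Fin 3 → Rk k)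
    (ha : a ⬝ᵥ ![X 0 ^ 2, X 0 * X 1, X 1 ^ 2] = 0) :
    ∑ i, (a ᵥ* (pencilMatrix α β).adjugate) i * pencil α β i = 0 := by
  change (a ᵥ* (pencilMatrix α β).adjugate) ⬝ᵥ pencil α β = 0
  rw [← pencilMatrix_mulVec, dotProduct_mulVec, vecMul_vecMul, adjugate_mul, vecMul_smul,
    vecMul_one, smul_dotProduct, ha, smul_zero]

lemma sum_syzOne (α β : Fin 3 → Fin 3 → k) : ∑ i, syzOne α β i * pencil α β i = 0 := by
  refine vecMul_adjugate_dotProduct α β _ ?_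
  simp only [dotProduct, Fin.sum_univ_three, Matrix.cons_val]
  ring

lemma sum_syzTwo (α β : Fin 3 → Fin 3 → k) : ∑ i, syzTwo α β i * pencil α β i = 0 := by
  refine vecMul_adjugate_dotProduct α β _ ?_
  simp only [dotProduct, Fin.sum_univ_three, Matrix.cons_val]
  ring

lemma bihom_adjugate (α β : Fin 3 → Fin 3 → k) (i j : Fin 3) :
    Bihom ((pencilMatrix α β).adjugate i j) 0 2 := by
  have h (i j) : Bihom (pencilMatrix α β i j) 0 1 :=
    IsWeightedHomogeneous.add (bihom_X2.mul' (bihom_C _)) (bihom_X3.mul' (bihom_C _))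
  have h2 (i j i' j') : Bihom (pencilMatrix α β i j * pencilMatrix α β i' j') 0 2 :=
    (h i j).mul' (h i' j')
  rw [Matrix.adjugate_fin_three]
  fin_cases i <;> fin_cases j
  · exact (h2 _ _ _ _).sub (h2 _ _ _ _)
  · exact (h2 _ _ _ _).neg.add (h2 _ _ _ _)
  · exact (h2 _ _ _ _).sub (h2 _ _ _ _)
  · exact (h2 _ _ _ _).neg.add (h2 _ _ _ _)
  · exact (h2 _ _ _ _).sub (h2 _ _ _ _)
  · exact (h2 _ _ _ _).neg.add (h2 _ _ _ _)
  · exact (h2 _ _ _ _).sub (h2 _ _ _ _)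
  · exact (h2 _ _ _ _).neg.add (h2 _ _ _ _)
  · exact (h2 _ _ _ _).sub (h2 _ _ _ _)

open Matrix in
lemma bihom_vecMul_adjugate (α β : Fin 3 → Fin 3 → k) {a : Fin 3 → Rk k}
    (ha : ∀ i, Bihom (a i) 1 0) (j : Fin 3) :
    Bihom ((a ᵥ* (pencilMatrix α β).adjugate) j) 1 2 :=
  IsWeightedHomogeneous.sum _ _ _ fun i _ => (ha i).mul' (bihom_adjugate α β i j)

lemma bihom_syzOne (α β : Fin 3 → Fin 3 → k) (j : Fin 3) : Bihom (syzOne α β j) 1 2 := by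
  refine bihom_vecMul_adjugate α β (fun i => ?_) j
  fin_cases i
  · exact bihom_X1
  · exact bihom_X0.neg
  · exact isWeightedHomogeneous_zero k bidegWt _

lemma bihom_syzTwo (α β : Fin 3 → Fin 3 → k) (j : Fin 3) : Bihom (syzTwo α β j) 1 2 := by
  refine bihom_vecMul_adjugate α β (fun i => ?_) j
  fin_cases i
  · exact isWeightedHomogeneous_zero k bidegWt _
  · exact bihom_X1
  · exact bihom_X0.neg

lemma exists_syz_quadrics {b : Fin 3 → Rk k}
    (h : b 0 * X 0 ^ 2 + b 1 * (X 0 * X 1) + b 2 * X 1 ^ 2 = 0) :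
    ∃ f g, b = fun i => f * (![X 1, -X 0, 0] : Fin 3 → Rk k) i +
      g * (![0, X 1, -X 0] : Fin 3 → Rk k) i := by
  have hx : (X 0 : Rk k) ≠ 0 := X_ne_zero _
  have hy : (X 1 : Rk k) ≠ 0 := X_ne_zero _
  have hr : IsRelPrime (X 0 : Rk k) (X 1) := by simpa using isRelPrime_X_pow (k := k) 1
  obtain ⟨f, hf⟩ : (X 1 : Rk k) ∣ b 0 := by
    refine (hr.symm.pow_right (n := 2)).dvd_of_dvd_mul_right (y := b 0) ?_
    exact ⟨-(b 1 * X 0 + b 2 * X 1), by linear_combination h⟩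
  have h' : f * X 0 ^ 2 + b 1 * X 0 + b 2 * X 1 = 0 := by
    refine (mul_eq_zero.1 ?_).resolve_left hy
    rw [hf] at h
    linear_combination h
  obtain ⟨g, hg⟩ : (X 0 : Rk k) ∣ b 2 := by
    refine hr.dvd_of_dvd_mul_right (y := b 2) ?_
    exact ⟨-(f * X 0 + b 1), by linear_combination h'⟩
  have h'' : f * X 0 + b 1 + g * X 1 = 0 := by
    refine (mul_eq_zero.1 ?_).resolve_left hx
    rw [hg] at h'
    linear_combination h'
  refine ⟨f, -g, ?_⟩
  ext1 i
  fin_cases i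
  · simp [hf]; ring
  · simp; linear_combination h''
  · simp [hg]; ring

/-- Syzygies of degree `0` in `z, w`. -/
lemma exists_eq_minors_mul [IsAlgClosed k] {α β : Fin 3 → Fin 3 → k}
    (h : NoCommonZeros (pencil α β 0) (pencil α β 1) (pencil α β 2)) {A : Fin 3 → Rk k}
    (hA : ∀ i, ZWHom (A i) 0) (e : ∑ i, A i * pencil α β i = 0) :
    ∃ c, ∀ i, A i = minors α β i * c := by
  obtain ⟨N, hx, hy⟩ := X_pow_mem_span_minors h
  have hq (q : Fin 3 → k) : ZWHom (quad q) 0 := (bihom_quad q).zwHom (n := 0)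
  obtain ⟨hu, hv⟩ : (∑ i, A i * quad (α i) = 0) ∧ (∑ i, A i * quad (β i) = 0) := by
    refine eq_zero_of_zw_one ?_ ?_ ?_
    · exact IsWeightedHomogeneous.sum _ _ _ fun i _ => by simpa using (hA i).mul (hq _)
    · exact IsWeightedHomogeneous.sum _ _ _ fun i _ => by simpa using (hA i).mul (hq _)
    · rw [← e]
      simp only [pencil, Fin.sum_univ_three]
      ring
  refine exists_eq_mul hx hy ?_
  rw [Fin.sum_univ_three] at hu hv
  intro i j
  fin_cases i <;> fin_cases j <;> simp [minors] <;> grind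

/-- The vector `(U ⬝ v) eᵢ + Vᵢ u - Uᵢ v`. -/
def crossAux {S : Type*} [CommRing S] (u v U V : Fin 3 → S) (i m : Fin 3) : S :=
  (if i = m then U 0 * v 0 + U 1 * v 1 + U 2 * v 2 else 0) + V i * u m - U i * v m

section crossAux

variable {S : Type*} [CommRing S] {u v U V : Fin 3 → S}

lemma cross_crossAux_left (h1 : U 0 * u 0 + U 1 * u 1 + U 2 * u 2 = 0) (i a : Fin 3) :
    crossProduct u v i * U a = crossProduct (crossAux u v U V i) u a := by
  simp only [crossAux, cross_apply]
  fin_cases i <;> fin_cases a <;> simp <;> grind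

lemma cross_crossAux_right
    (h2 : U 0 * v 0 + U 1 * v 1 + U 2 * v 2 + (V 0 * u 0 + V 1 * u 1 + V 2 * u 2) = 0)
    (h3 : V 0 * v 0 + V 1 * v 1 + V 2 * v 2 = 0) (i a : Fin 3) :
    crossProduct u v i * V a = crossProduct (crossAux u v U V i) v a := by
  simp only [crossAux, cross_apply]
  fin_cases i <;> fin_cases a <;> simp <;> grind

set_option maxHeartbeats 1000000 in
lemma crossAux_mul_cross (h1 : U 0 * u 0 + U 1 * u 1 + U 2 * u 2 = 0)
    (h2 : U 0 * v 0 + U 1 * v 1 + U 2 * v 2 + (V 0 * u 0 + V 1 * u 1 + V 2 * u 2) = 0)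
    (h3 : V 0 * v 0 + V 1 * v 1 + V 2 * v 2 = 0) (m i j : Fin 3) :
    crossAux u v U V i m * crossProduct u v j = crossAux u v U V j m * crossProduct u v i := by
  simp only [crossAux, cross_apply]
  fin_cases m <;> fin_cases i <;> fin_cases j <;> simp <;> grind

lemma eq_cross_of_crossAux [IsDomain S] (h1 : U 0 * u 0 + U 1 * u 1 + U 2 * u 2 = 0)
    (h2 : U 0 * v 0 + U 1 * v 1 + U 2 * v 2 + (V 0 * u 0 + V 1 * u 1 + V 2 * u 2) = 0)
    (h3 : V 0 * v 0 + V 1 * v 1 + V 2 * v 2 = 0) {i : Fin 3} (hi : crossProduct u v i ≠ 0)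
    {c : Fin 3 → S} (hc : ∀ m, crossAux u v U V i m = crossProduct u v i * c m) :
    U = crossProduct c u ∧ V = crossProduct c v := by
  have hc' : crossAux u v U V i = crossProduct u v i • c := funext hc
  constructor <;> ext1 a <;> refine mul_left_cancel₀ hi ?_
  · rw [cross_crossAux_left (V := V) h1, hc', map_smul, LinearMap.smul_apply, Pi.smul_apply,
      smul_eq_mul]
  · rw [cross_crossAux_right h2 h3, hc', map_smul, LinearMap.smul_apply, Pi.smul_apply,
      smul_eq_mul]

end crossAux

lemma exists_eq_cross_of_pow_mem {u v U V : Fin 3 → Rk k} {N : ℕ}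
    (hx : (X 0 : Rk k) ^ N ∈ Ideal.span (Set.range (crossProduct u v)))
    (hy : (X 1 : Rk k) ^ N ∈ Ideal.span (Set.range (crossProduct u v)))
    (h1 : U 0 * u 0 + U 1 * u 1 + U 2 * u 2 = 0)
    (h2 : U 0 * v 0 + U 1 * v 1 + U 2 * v 2 + (V 0 * u 0 + V 1 * u 1 + V 2 * u 2) = 0)
    (h3 : V 0 * v 0 + V 1 * v 1 + V 2 * v 2 = 0) :
    ∃ c, U = crossProduct c u ∧ V = crossProduct c v := by
  obtain ⟨i, hi⟩ := exists_ne_zero_of_X_pow_mem hx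
  have hex (m : Fin 3) : ∃ c, ∀ i, crossAux u v U V i m = crossProduct u v i * c :=
    exists_eq_mul hx hy (crossAux_mul_cross h1 h2 h3 m)
  choose c hc using hex
  exact ⟨c, eq_cross_of_crossAux h1 h2 h3 hi fun m => hc m i⟩

/-- The exactness, in degree one in `z, w`, of the Koszul complex. -/
lemma exists_eq_cross [IsAlgClosed k] {α β : Fin 3 → Fin 3 → k}
    (h : NoCommonZeros (pencil α β 0) (pencil α β 1) (pencil α β 2)) {A : Fin 3 → Rk k}
    (hA : ∀ i, ZWHom (A i) 1) (e : ∑ i, A i * pencil α β i = 0) :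
    ∃ c : Fin 3 → Rk k, A = crossProduct c (pencil α β) := by
  obtain ⟨N, hx, hy⟩ := X_pow_mem_span_minors h
  have hq (q : Fin 3 → k) : ZWHom (quad q) 0 := (bihom_quad q).zwHom (n := 0)
  choose U V hU hV hUV using fun i => exists_zw_decomp (n := 0) (hA i)
  have hs {F : Fin 3 → Rk k} (hF : ∀ i, ZWHom (F i) 0) (γ : Fin 3 → Fin 3 → k) :
      ZWHom (∑ i, F i * quad (γ i)) 0 :=
    IsWeightedHomogeneous.sum _ _ _ fun i _ => by simpa using (hF i).mul (hq _)
  obtain ⟨h1, h2, h3⟩ := eq_zero_of_zw_two (hs hU α) ((hs hU β).add (hs hV α)) (hs hV β) (by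
    rw [← e]
    simp only [hUV, pencil, Fin.sum_univ_three]
    ring)
  rw [Fin.sum_univ_three] at h1 h3
  rw [Fin.sum_univ_three, Fin.sum_univ_three] at h2
  let u : Fin 3 → Rk k := fun i => quad (α i)
  let v : Fin 3 → Rk k := fun i => quad (β i)
  have hmin : minors α β = crossProduct u v := by
    rw [cross_apply]
    rfl
  rw [hmin] at hx hy
  obtain ⟨c, hUc, hVc⟩ := exists_eq_cross_of_pow_mem hx hy h1 h2 h3
  refine ⟨c, ?_⟩
  have hp : pencil α β = (X 2 : Rk k) • u + (X 3 : Rk k) • v := rfl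
  rw [hp, map_add, map_smul, map_smul, ← hUc, ← hVc]
  exact funext hUV

open Matrix in
lemma sum_C_mul_pencil (α β : Matrix (Fin 3) (Fin 3) k) (a : Fin 3 → k) :
    ∑ i, C (a i) * pencil α β i = X 2 * quad (a ᵥ* α) + X 3 * quad (a ᵥ* β) := by
  simp only [pencil, quad, vecMul, dotProduct, Fin.sum_univ_three, map_add, map_mul]
  ring

lemma quad_smul (c : k) (q : Fin 3 → k) : quad (c • q) = C c * quad q := by
  simp only [quad, Pi.smul_apply, smul_eq_mul, map_mul]
  ring

open Matrix in
/-- In the generic case, some member of the pencil of coefficient matrices is invertible. -/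
lemma exists_det_ne_zero [IsAlgClosed k] {α β : Matrix (Fin 3) (Fin 3) k}
    (h : NoCommonZeros (pencil α β 0) (pencil α β 1) (pencil α β 2))
    (hg : BidegGeneric (pencil α β 0) (pencil α β 1) (pencil α β 2)) :
    ∃ c : k, (c • α + β).det ≠ 0 := by
  by_contra! hdet
  choose a ha0 ha using fun c => exists_vecMul_eq_zero_iff.2 (hdet c)
  let P (c : k) : Projectivization k (Fin 3 → k) := .mk k (a c) (ha0 c)
  have hrep (c : k) : c • ((P c).rep ᵥ* α) + (P c).rep ᵥ* β = 0 := by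
    obtain ⟨e, he⟩ := Projectivization.exists_smul_eq_mk_rep k (a c) (ha0 c)
    change e • a c = (P c).rep at he
    rw [← he, ← vecMul_smul, ← vecMul_add, Units.smul_def, smul_vecMul, ha, smul_zero]
  have hP : ¬ Function.Injective P := by
    intro hinj
    refine Set.infinite_of_injective_forall_mem hinj (fun c => ?_) hg
    refine ⟨quad ((P c).rep ᵥ* α), X 2 - C c * X 3, bihom_quad _,
      bihom_X2.sub (by simpa [Bihom] using (bihom_C c).mul' bihom_X3), ?_⟩
    have := sum_C_mul_pencil α β (P c).rep
    rw [eq_neg_of_add_eq_zero_right (hrep c), ← neg_smul, quad_smul, Fin.sum_univ_three] at this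
    rw [smul_eq_C_mul, smul_eq_C_mul, smul_eq_C_mul, this, C_neg]
    ring
  rw [Function.not_injective_iff] at hP
  obtain ⟨c, c', hcc, hne⟩ := hP
  have h1 := hrep c
  have h2 := hrep c'
  rw [← hcc] at h2
  have hα : (P c).rep ᵥ* α = 0 := by
    refine (smul_eq_zero.1 (?_ : (c - c') • ((P c).rep ᵥ* α) = 0)).resolve_left (sub_ne_zero.2 hne)
    rw [sub_smul]
    exact sub_eq_zero.2 (add_right_cancel (h1.trans h2.symm))
  have hβ : (P c).rep ᵥ* β = 0 := by rwa [hα, smul_zero, zero_add] at h1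
  refine (P c).rep_nonzero (eq_zero_of_sum_pencil h ?_)
  rw [sum_C_mul_pencil, hα, hβ]
  simp [quad]

open Matrix in
lemma map_pencilMatrix (α β : Matrix (Fin 3) (Fin 3) k) (c : k) :
    (pencilMatrix α β).map (specZW c 1) = (c • α + β).map C := by
  ext1 i j
  simp [pencilMatrix]

open Matrix in
lemma specZW_vecMul_adjugate (α β : Matrix (Fin 3) (Fin 3) k) (c : k) {a : Fin 3 → Rk k}
    (ha : ∀ i, ZWHom (a i) 0) (j : Fin 3) :
    specZW c 1 ((a ᵥ* (pencilMatrix α β).adjugate) j) =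
      (a ᵥ* ((c • α + β).map C).adjugate) j := by
  have h := (specZW c 1).map_adjugate (pencilMatrix α β)
  rw [AlgHom.mapMatrix_apply, AlgHom.mapMatrix_apply, map_pencilMatrix] at h
  rw [← h]
  simp [vecMul, dotProduct, specZW_of_zwHom_zero (ha _)]

open Matrix in
/-- The specialization of a syzygy is a combination of those of `syzOne` and `syzTwo`. -/
lemma exists_specZW_eq (α β : Matrix (Fin 3) (Fin 3) k) (c : k) {A : Fin 3 → Rk k}
    (e : ∑ i, A i * pencil α β i = 0) :
    ∃ f g, ZWHom f 0 ∧ ZWHom g 0 ∧ ∀ j, C (c • α + β).det * specZW c 1 (A j) =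
      f * specZW c 1 (syzOne α β j) + g * specZW c 1 (syzTwo α β j) := by
  set Q : Matrix (Fin 3) (Fin 3) (Rk k) := (c • α + β).map C with hQ
  set a : Fin 3 → Rk k := fun i => specZW c 1 (A i) with ha
  have hspec (i : Fin 3) : specZW c 1 (pencil α β i) =
      Q i 0 * X 0 ^ 2 + Q i 1 * (X 0 * X 1) + Q i 2 * X 1 ^ 2 := by
    simp [Q, pencil, quad]
    ring
  have he := congrArg (specZW c 1) e
  rw [Fin.sum_univ_three] at he
  simp only [map_add, map_mul, hspec, map_zero] at he
  obtain ⟨f, g, hfg⟩ := exists_syz_quadrics (b := a ᵥ* Q) (by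
    simp only [vecMul, dotProduct, Fin.sum_univ_three, ha]
    linear_combination he)
  have h1 (j : Fin 3) : specZW c 1 (syzOne α β j) = (![X 1, -X 0, 0] ᵥ* Q.adjugate) j := by
    refine specZW_vecMul_adjugate α β c (fun i => ?_) j
    fin_cases i
    exacts [zwHom_X1, zwHom_X0.neg, isWeightedHomogeneous_zero _ _ _]
  have h2 (j : Fin 3) : specZW c 1 (syzTwo α β j) = (![0, X 1, -X 0] ᵥ* Q.adjugate) j := by
    refine specZW_vecMul_adjugate α β c (fun i => ?_) j
    fin_cases i
    exacts [isWeightedHomogeneous_zero _ _ _, zwHom_X1, zwHom_X0.neg]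
  have hdet : Q.det = C (c • α + β).det := ((C : k →+* Rk k).map_det (c • α + β)).symm
  have h3 : (C (c • α + β).det : Rk k) • a = f • (![X 1, -X 0, 0] ᵥ* Q.adjugate) +
      g • (![0, X 1, -X 0] ᵥ* Q.adjugate) := by
    rw [← smul_vecMul, ← smul_vecMul, ← add_vecMul]
    have : f • ![X 1, -X 0, 0] + g • ![0, X 1, -X 0] = a ᵥ* Q := hfg.symm
    rw [this, vecMul_vecMul, mul_adjugate, vecMul_smul, vecMul_one, hdet]
  refine ⟨specZW c 1 f, specZW c 1 g, zwHom_specZW _ _ _, zwHom_specZW _ _ _, fun j => ?_⟩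
  have h4 : C (c • α + β).det * a j = f * specZW c 1 (syzOne α β j) +
      g * specZW c 1 (syzTwo α β j) := by
    rw [h1, h2]
    exact congrFun h3 j
  have := congrArg (specZW c 1) h4
  simpa only [ha, map_mul, map_add, specZW_C, specZW_of_zwHom_zero (zwHom_specZW _ _ _)] using this

lemma mem_of_zwHom [IsAlgClosed k] {α β : Matrix (Fin 3) (Fin 3) k}
    (h : NoCommonZeros (pencil α β 0) (pencil α β 1) (pencil α β 2)) {c : k}
    (hc : (c • α + β).det ≠ 0) {M : Submodule (Rk k) (Fin 3 → Rk k)} (hs : minors α β ∈ M)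
    (hK : ∀ c, crossProduct c (pencil α β) ∈ M) (h1 : syzOne α β ∈ M) (h2 : syzTwo α β ∈ M) :
    ∀ (n : ℕ) (A : Fin 3 → Rk k), (∀ i, ZWHom (A i) n) → ∑ i, A i * pencil α β i = 0 → A ∈ M
  | 0, A, hA, e => by
    obtain ⟨c, hc⟩ := exists_eq_minors_mul h hA e
    convert M.smul_mem c hs using 1
    ext1 i
    rw [hc, mul_comm]
    rfl
  | 1, A, hA, e => by
    obtain ⟨c, rfl⟩ := exists_eq_cross h hA e
    exact hK c
  | n + 2, A, hA, e => by
    obtain ⟨f, g, hf, hg, hfg⟩ := exists_specZW_eq α β c e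
    set δ := (c • α + β).det
    have hδ : (C δ⁻¹ * C δ : Rk k) = 1 := by rw [← C_mul, inv_mul_cancel₀ hc, C_1]
    set q : Rk k := C δ⁻¹ * X 3 ^ n with hq
    have hqh : ZWHom q n := by
      refine IsWeightedHomogeneous.C_mul ?_ _
      simpa using zwHom_X3.pow n
    let T (j : Fin 3) : Rk k := A j - (q * f * syzOne α β j + q * g * syzTwo α β j)
    have hT (j : Fin 3) : ZWHom (T j) (n + 2) := by
      have e1 := (hqh.mul hf).mul ((bihom_syzOne α β j).zwHom (n := 2))
      have e2 := (hqh.mul hg).mul ((bihom_syzTwo α β j).zwHom (n := 2))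
      exact (hA j).sub (e1.add e2)
    have hT0 (j : Fin 3) : specZW c 1 (T j) = 0 := by
      simp only [T, hq, map_sub, map_add, map_mul, map_pow, specZW_C, specZW_X3,
        specZW_of_zwHom_zero hf, specZW_of_zwHom_zero hg, C_1, one_pow, mul_one]
      linear_combination C δ⁻¹ * hfg j - specZW c 1 (A j) * hδ
    choose G hG hTG using fun j => exists_spec_decomp c (n := n + 1) (hT j)
    simp only [hT0, mul_zero, zero_add] at hTG
    have hl : (X 2 - C c * X 3 : Rk k) ≠ 0 := by
      intro h0
      have := congrArg (specZW 1 0) h0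
      simp at this
    have hGs : ∑ i, G i * pencil α β i = 0 := by
      refine (mul_eq_zero.1 ?_).resolve_left hl
      have e1 := sum_syzOne α β
      have e2 := sum_syzTwo α β
      rw [Fin.sum_univ_three] at e e1 e2 ⊢
      simp only [T] at hTG
      linear_combination e - q * f * e1 - q * g * e2 - pencil α β 0 * hTG 0 -
        pencil α β 1 * hTG 1 - pencil α β 2 * hTG 2
    have hA' : A = (X 2 - C c * X 3 : Rk k) • G + ((q * f) • syzOne α β + (q * g) • syzTwo α β) := by
      ext1 j
      have := hTG j
      simp only [T] at this
      simp only [Pi.add_apply, Pi.smul_apply, smul_eq_mul]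
      linear_combination this
    rw [hA']
    exact M.add_mem (M.smul_mem _ (mem_of_zwHom h hc hs hK h1 h2 (n + 1) G hG hGs))
      (M.add_mem (M.smul_mem _ h1) (M.smul_mem _ h2))

lemma weightedHomogeneousComponent_mul_add {σ R M : Type*} [CommSemiring R] [AddCancelCommMonoid M]
    {w : σ → M} {f : MvPolynomial σ R} {m : M} (hf : f.IsWeightedHomogeneous w m) (n : M)
    (g : MvPolynomial σ R) :
    weightedHomogeneousComponent w (n + m) (g * f) = weightedHomogeneousComponent w n g * f := by
  classical
  let := weightedGradedAlgebra R w
  have := DirectSum.coe_decompose_mul_add_of_right_mem (weightedHomogeneousSubmodule R w)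
    (a := g) (i := n) hf
  have key (φ : MvPolynomial σ R) (d : M) :
      (DirectSum.decompose (weightedHomogeneousSubmodule R w) φ d : MvPolynomial σ R) =
        weightedHomogeneousComponent w d φ := decompose'_apply R w φ d
  rwa [key, key] at this

lemma mem_of_sum_pencil [IsAlgClosed k] {α β : Matrix (Fin 3) (Fin 3) k}
    (h : NoCommonZeros (pencil α β 0) (pencil α β 1) (pencil α β 2)) {c : k}
    (hc : (c • α + β).det ≠ 0) {M : Submodule (Rk k) (Fin 3 → Rk k)} (hs : minors α β ∈ M)
    (hK : ∀ c, crossProduct c (pencil α β) ∈ M) (h1 : syzOne α β ∈ M) (h2 : syzTwo α β ∈ M)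
    (A : Fin 3 → Rk k) (e : ∑ i, A i * pencil α β i = 0) : A ∈ M := by
  classical
  have hfin (i : Fin 3) := weightedHomogeneousComponent_finsupp (w := zwWt) (A i)
  let S : Finset ℕ := Finset.univ.biUnion fun i => (hfin i).toFinset
  have hA : A = ∑ n ∈ S, fun i => weightedHomogeneousComponent zwWt n (A i) := by
    ext1 i
    rw [Finset.sum_apply]
    conv_lhs => rw [← finsum_weightedHomogeneousComponent zwWt (A i)]
    refine finsum_eq_sum_of_support_subset _ fun n hn => ?_
    exact Finset.mem_biUnion.2 ⟨i, Finset.mem_univ i, (hfin i).mem_toFinset.2 hn⟩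
  rw [hA]
  refine M.sum_mem fun n _ => mem_of_zwHom h hc hs hK h1 h2 n _
    (fun i => weightedHomogeneousComponent_isWeightedHomogeneous n _) ?_
  have hp (i : Fin 3) : ZWHom (pencil α β i) 1 := by
    have hq (q : Fin 3 → k) : ZWHom (quad q) 0 := (bihom_quad q).zwHom (n := 0)
    exact IsWeightedHomogeneous.add (zwHom_X2.mul (hq _)) (zwHom_X3.mul (hq _))
  simp only [← weightedHomogeneousComponent_mul_add (hp _), ← map_sum, e, map_zero]

/-- A family whose relations all have coefficients in the kernel of a ring homomorphism to a field
is a minimal generating family of its span. -/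
lemma card_le_of_span_eq_span_range {R M K ι : Type*} [CommRing R] [AddCommGroup M] [Module R M]
    [Field K] [Fintype ι] (ε : R →+* K) {G : ι → M}
    (hG : ∀ r : ι → R, ∑ i, r i • G i = 0 → ∀ i, ε (r i) = 0) {S : Finset M}
    (hS : Submodule.span R (S : Set M) = Submodule.span R (Set.range G)) :
    Fintype.card ι ≤ S.card := by
  classical
  have hGS (i : ι) : ∃ f : S → R, ∑ j, f j • (j : M) = G i := by
    have h : G i ∈ Submodule.span R (S : Set M) :=
      hS ▸ Submodule.subset_span (Set.mem_range_self i)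
    rwa [← Subtype.range_coe (s := (S : Set M)), Submodule.mem_span_range_iff_exists_fun] at h
  have hSG (j : S) : ∃ f : ι → R, ∑ i, f i • G i = j := by
    have h : (j : M) ∈ Submodule.span R (Set.range G) := hS ▸ Submodule.subset_span j.2
    rwa [Submodule.mem_span_range_iff_exists_fun] at h
  choose A hA using hGS
  choose B hB using hSG
  have hmul : (Matrix.of A).map ε * (Matrix.of B).map ε = 1 := by
    rw [← Matrix.map_mul]
    ext i l
    have h := hG (fun l => (Matrix.of A * Matrix.of B - 1 : Matrix ι ι R) i l) (by
      simp only [Matrix.sub_apply, sub_smul, Finset.sum_sub_distrib, Matrix.mul_apply,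
        Matrix.of_apply, Finset.sum_smul, Matrix.one_apply, ite_smul, one_smul, zero_smul,
        Finset.sum_ite_eq, Finset.mem_univ, if_true]
      rw [Finset.sum_comm, sub_eq_zero]
      simp only [mul_smul, ← Finset.smul_sum, hB, hA]) l
    rw [Matrix.sub_apply, map_sub, sub_eq_zero] at h
    rw [Matrix.map_apply, h, Matrix.one_apply, Matrix.one_apply]
    split_ifs <;> simp
  have h1 := Matrix.rank_mul_le_left ((Matrix.of A).map ε) ((Matrix.of B).map ε)
  rw [hmul, Matrix.rank_one] at h1
  exact (h1.trans (Matrix.rank_le_card_width _)).trans_eq (Fintype.card_coe S)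

lemma bihomComponent_mul_self {f : Rk k} {m n : ℤ} (hf : Bihom f m n) (g : Rk k) :
    weightedHomogeneousComponent bidegWt (m, n) (g * f) = C (constantCoeff g) * f := by
  have h := weightedHomogeneousComponent_mul_add hf 0 g
  rw [zero_add] at h
  rw [h]
  congr 1
  classical
  ext d
  rw [coeff_weightedHomogeneousComponent, coeff_C, constantCoeff_eq]
  have hd : Finsupp.weight bidegWt d = 0 ↔ 0 = d := by
    constructor
    · intro h0
      rw [weight_bideg, Prod.mk_eq_zero] at h0
      ext i
      fin_cases i <;> simp <;> omega
    · rintro rfl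
      simp
  simp only [hd]
  split_ifs with h0
  · rw [h0]
  · rfl

lemma bihomComponent_mul_of_lt {f : Rk k} {m n m' n' : ℤ} (hf : Bihom f m n) (g : Rk k)
    (h : m' < m ∨ n' < n) : weightedHomogeneousComponent bidegWt (m', n') (g * f) = 0 := by
  have h1 := weightedHomogeneousComponent_mul_add hf (m' - m, n' - n) g
  rw [Prod.mk_add_mk, sub_add_cancel, sub_add_cancel] at h1
  rw [h1, weightedHomogeneousComponent_eq_zero', zero_mul]
  intro d _ h2
  rw [weight_bideg, Prod.mk.injEq] at h2
  omega

lemma bihom_pencil (α β : Fin 3 → Fin 3 → k) (i : Fin 3) : Bihom (pencil α β i) 2 1 :=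
  IsWeightedHomogeneous.add (bihom_X2.mul' (bihom_quad _)) (bihom_X3.mul' (bihom_quad _))

open Matrix in
lemma det_pencilMatrix_ne_zero {α β : Matrix (Fin 3) (Fin 3) k} {c : k}
    (hc : (c • α + β).det ≠ 0) : (pencilMatrix α β).det ≠ 0 := by
  intro h
  have h1 := (specZW c 1).map_det (pencilMatrix α β)
  rw [h, map_zero, AlgHom.mapMatrix_apply, map_pencilMatrix] at h1
  have h2 := (C : k →+* Rk k).map_det (c • α + β)
  rw [RingHom.mapMatrix_apply, ← h1, C_eq_zero] at h2
  exact hc h2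

open Matrix in
lemma eq_zero_of_syz_combination {α β : Matrix (Fin 3) (Fin 3) k} {c : k}
    (hc : (c • α + β).det ≠ 0) {a b : k}
    (h : ∀ j, C a * syzOne α β j + C b * syzTwo α β j = 0) : a = 0 ∧ b = 0 := by
  have h1 : ((C a : Rk k) • ![X 1, -X 0, 0] + (C b : Rk k) • ![0, X 1, -X 0]) ᵥ*
      (pencilMatrix α β).adjugate = 0 := by
    rw [add_vecMul, smul_vecMul, smul_vecMul]
    exact funext h
  have h2 := congrArg (· ᵥ* pencilMatrix α β) h1
  simp only [vecMul_vecMul, adjugate_mul, vecMul_smul, vecMul_one, zero_vecMul] at h2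
  have h3 := (smul_eq_zero.1 h2).resolve_left (det_pencilMatrix_ne_zero hc)
  have h4 := congrFun h3 0
  have h5 := congrFun h3 2
  simpa [X_ne_zero] using And.intro h4 h5

lemma eq_zero_of_cross_pencil [IsAlgClosed k] {α β : Fin 3 → Fin 3 → k}
    (h : NoCommonZeros (pencil α β 0) (pencil α β 1) (pencil α β 2)) {a : Fin 3 → k}
    (ha : ∀ j, crossProduct (fun i => (C (a i) : Rk k)) (pencil α β) j = 0) : a = 0 := by
  simp only [cross_apply] at ha
  have h0 := eq_zero_of_sum_pencil h (a := ![0, -a 2, a 1]) (by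
    have := ha 0
    simp [Fin.sum_univ_three] at this ⊢
    linear_combination this)
  have h1 := eq_zero_of_sum_pencil h (a := ![a 2, 0, -a 0]) (by
    have := ha 1
    simp [Fin.sum_univ_three] at this ⊢
    linear_combination this)
  ext1 i
  fin_cases i
  · simpa using congrFun h1 2
  · simpa using congrFun h0 2
  · simpa using congrFun h1 0

/-- There are no relations with nonzero constant terms between the six generators. -/
lemma constantCoeff_eq_zero [IsAlgClosed k] {α β : Matrix (Fin 3) (Fin 3) k}
    (h : NoCommonZeros (pencil α β 0) (pencil α β 1) (pencil α β 2)) {c : k}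
    (hc : (c • α + β).det ≠ 0) {r r1 r2 : Rk k} {r' : Fin 3 → Rk k}
    (e : r • minors α β + crossProduct r' (pencil α β) + r1 • syzOne α β + r2 • syzTwo α β = 0) :
    constantCoeff r = 0 ∧ (∀ i, constantCoeff (r' i) = 0) ∧ constantCoeff r1 = 0 ∧
      constantCoeff r2 = 0 := by
  have hs := bihom_minors α β
  have h1 := bihom_syzOne α β
  have h2 := bihom_syzTwo α β
  have hp := bihom_pencil α β
  have e' (j : Fin 3) : r * minors α β j + crossProduct r' (pencil α β) j + r1 * syzOne α β j +
      r2 * syzTwo α β j = 0 := congrFun e j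
  refine ⟨?_, ?_, ?_⟩
  · obtain ⟨N, hx, -⟩ := X_pow_mem_span_minors h
    obtain ⟨j, hj⟩ := exists_ne_zero_of_X_pow_mem hx
    have h4 := congrArg (weightedHomogeneousComponent bidegWt ((4 : ℤ), (0 : ℤ))) (e' j)
    have hK : weightedHomogeneousComponent bidegWt ((4 : ℤ), (0 : ℤ))
        (crossProduct r' (pencil α β) j) = 0 := by
      rw [cross_apply]
      fin_cases j <;> simp [bihomComponent_mul_of_lt (hp _)]
    rw [map_add, map_add, map_add, bihomComponent_mul_self (hs j), hK,
      bihomComponent_mul_of_lt (h1 j) _ (by norm_num),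
      bihomComponent_mul_of_lt (h2 j) _ (by norm_num), map_zero] at h4
    simpa [hj] using h4
  · refine fun i => congrFun (eq_zero_of_cross_pencil h (a := fun i => constantCoeff (r' i))
      fun j => ?_) i
    have h4 := congrArg (weightedHomogeneousComponent bidegWt ((2 : ℤ), (1 : ℤ))) (e' j)
    have hK : weightedHomogeneousComponent bidegWt ((2 : ℤ), (1 : ℤ))
        (crossProduct r' (pencil α β) j) =
          crossProduct (fun i => (C (constantCoeff (r' i)) : Rk k)) (pencil α β) j := by
      rw [cross_apply, cross_apply]
      fin_cases j <;> simp [bihomComponent_mul_self (hp _)]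
    rw [map_add, map_add, map_add, hK, bihomComponent_mul_of_lt (hs j) _ (by norm_num),
      bihomComponent_mul_of_lt (h1 j) _ (by norm_num),
      bihomComponent_mul_of_lt (h2 j) _ (by norm_num), map_zero] at h4
    simpa using h4
  · refine eq_zero_of_syz_combination hc fun j => ?_
    have h4 := congrArg (weightedHomogeneousComponent bidegWt ((1 : ℤ), (2 : ℤ))) (e' j)
    have hK : weightedHomogeneousComponent bidegWt ((1 : ℤ), (2 : ℤ))
        (crossProduct r' (pencil α β) j) = 0 := by
      rw [cross_apply]
      fin_cases j <;> simp [bihomComponent_mul_of_lt (hp _)]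
    rw [map_add, map_add, map_add, hK, bihomComponent_mul_self (h1 j),
      bihomComponent_mul_self (h2 j),
      bihomComponent_mul_of_lt (hs j) _ (by norm_num), map_zero] at h4
    simpa using h4

lemma mem_syz {p A : Fin 3 → Rk k} : A ∈ Syz p ↔ ∑ i, A i * p i = 0 := by
  simp [Syz]

lemma mem_syzPiece {p A : Fin 3 → Rk k} {m n m' n' : ℤ} (hm : m - 2 = m') (hn : n - 1 = n')
    (hA : ∀ i, Bihom (A i) m' n') (e : ∑ i, A i * p i = 0) : A ∈ SyzPiece p m n := by
  refine ⟨fun i _ => ?_, ?_⟩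
  · rw [hm, hn]
    exact hA i
  · simpa [syzMapk] using e

lemma sum_minors_mul (α β : Fin 3 → Fin 3 → k) : ∑ i, minors α β i * pencil α β i = 0 := by
  simp only [minors, pencil, Fin.sum_univ_three, Matrix.cons_val]
  ring

lemma cross_eq_koszul (p c : Fin 3 → Rk k) : crossProduct c p =
    (-c 2) • ![p 1, -p 0, 0] + c 1 • ![p 2, 0, -p 0] + (-c 0) • ![0, p 2, -p 1] := by
  rw [cross_apply]
  ext1 i
  fin_cases i <;> simp <;> ring

/-- The six generators of the syzygy module. -/
def syzGens (α β : Fin 3 → Fin 3 → k) : Fin 6 → Fin 3 → Rk k :=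
  ![minors α β, ![pencil α β 1, -pencil α β 0, 0], ![pencil α β 2, 0, -pencil α β 0],
    ![0, pencil α β 2, -pencil α β 1], syzOne α β, syzTwo α β]

lemma range_syzGens (α β : Fin 3 → Fin 3 → k) : Set.range (syzGens α β) =
    {minors α β, ![pencil α β 1, -pencil α β 0, 0], ![pencil α β 2, 0, -pencil α β 0],
      ![0, pencil α β 2, -pencil α β 1], syzOne α β, syzTwo α β} := by
  simp only [syzGens, Matrix.range_cons, Matrix.range_empty, Set.union_empty,
    Set.singleton_union]

lemma sum_syzGens (α β : Fin 3 → Fin 3 → k) (i : Fin 6) :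
    ∑ j, syzGens α β i j * pencil α β j = 0 := by
  fin_cases i
  · exact sum_minors_mul α β
  · simp [syzGens, Fin.sum_univ_three]
    ring
  · simp [syzGens, Fin.sum_univ_three]
    ring
  · simp [syzGens, Fin.sum_univ_three]
    ring
  · exact sum_syzOne α β
  · exact sum_syzTwo α β

lemma span_syzGens [IsAlgClosed k] {α β : Matrix (Fin 3) (Fin 3) k}
    (h : NoCommonZeros (pencil α β 0) (pencil α β 1) (pencil α β 2)) {c : k}
    (hc : (c • α + β).det ≠ 0) :
    Submodule.span (Rk k) (Set.range (syzGens α β)) = Syz (pencil α β) := by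
  refine le_antisymm (Submodule.span_le.2 ?_) fun A hA => ?_
  · rintro _ ⟨i, rfl⟩
    exact mem_syz.2 (sum_syzGens α β i)
  · have hG (i : Fin 6) : syzGens α β i ∈ Submodule.span (Rk k) (Set.range (syzGens α β)) :=
      Submodule.subset_span (Set.mem_range_self i)
    refine mem_of_sum_pencil h hc (hG 0) (fun c => ?_) (hG 4) (hG 5) A (mem_syz.1 hA)
    rw [cross_eq_koszul]
    exact add_mem (add_mem (Submodule.smul_mem _ _ (hG 1)) (Submodule.smul_mem _ _ (hG 2)))
      (Submodule.smul_mem _ _ (hG 3))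

lemma six_le_card [IsAlgClosed k] {α β : Matrix (Fin 3) (Fin 3) k}
    (h : NoCommonZeros (pencil α β 0) (pencil α β 1) (pencil α β 2)) {c : k}
    (hc : (c • α + β).det ≠ 0) {S : Finset (Fin 3 → Rk k)}
    (hS : Submodule.span (Rk k) (S : Set (Fin 3 → Rk k)) = Syz (pencil α β)) : 6 ≤ S.card := by
  rw [← span_syzGens h hc] at hS
  refine (Fintype.card_fin 6).symm.trans_le (card_le_of_span_eq_span_range constantCoeff ?_ hS)
  intro r hr
  obtain ⟨e0, e1, e4, e5⟩ := constantCoeff_eq_zero h hc (r := r 0) (r' := ![-r 3, r 2, -r 1])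
    (r1 := r 4) (r2 := r 5) (by
      rw [← hr, cross_eq_koszul]
      simp [Fin.sum_univ_six, syzGens, add_assoc])
  have e3 := e1 0
  have e2 := e1 1
  have e1 := e1 2
  simp only [Matrix.cons_val, map_neg, neg_eq_zero] at e1 e2 e3
  intro i
  fin_cases i <;> assumption

lemma koszul_mem_syzPiece (α β : Fin 3 → Fin 3 → k) :
    ![pencil α β 1, -pencil α β 0, 0] ∈ SyzPiece (pencil α β) 4 2 ∧
      ![pencil α β 2, 0, -pencil α β 0] ∈ SyzPiece (pencil α β) 4 2 ∧
      ![0, pencil α β 2, -pencil α β 1] ∈ SyzPiece (pencil α β) 4 2 := by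
  have hp := bihom_pencil α β
  have h0 : Bihom (0 : Rk k) 2 1 := isWeightedHomogeneous_zero k bidegWt _
  have hm : (4 : ℤ) - 2 = 2 := by norm_num
  have hn : (2 : ℤ) - 1 = 1 := by norm_num
  refine ⟨mem_syzPiece hm hn (fun i => ?_) (sum_syzGens α β 1),
    mem_syzPiece hm hn (fun i => ?_) (sum_syzGens α β 2),
    mem_syzPiece hm hn (fun i => ?_) (sum_syzGens α β 3)⟩ <;> fin_cases i
  exacts [hp 1, (hp 0).neg, h0, hp 2, h0, (hp 0).neg, h0, hp 2, (hp 1).neg]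

/-- The six minimal generators, in terms of the coefficient matrices of the three forms. -/
lemma exists_minimal_generators [IsAlgClosed k] {α β : Matrix (Fin 3) (Fin 3) k}
    (h : NoCommonZeros (pencil α β 0) (pencil α β 1) (pencil α β 2))
    (hg : BidegGeneric (pencil α β 0) (pencil α β 1) (pencil α β 2)) :
    (∃ s t1 t2 : Fin 3 → Rk k,
      s ∈ SyzPiece ![pencil α β 0, pencil α β 1, pencil α β 2] 6 1 ∧
      t1 ∈ SyzPiece ![pencil α β 0, pencil α β 1, pencil α β 2] 3 3 ∧
      t2 ∈ SyzPiece ![pencil α β 0, pencil α β 1, pencil α β 2] 3 3 ∧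
      ![pencil α β 1, -pencil α β 0, 0] ∈
        SyzPiece ![pencil α β 0, pencil α β 1, pencil α β 2] 4 2 ∧
      ![pencil α β 2, 0, -pencil α β 0] ∈
        SyzPiece ![pencil α β 0, pencil α β 1, pencil α β 2] 4 2 ∧
      ![0, pencil α β 2, -pencil α β 1] ∈
        SyzPiece ![pencil α β 0, pencil α β 1, pencil α β 2] 4 2 ∧
      Submodule.span (Rk k) {s, ![pencil α β 1, -pencil α β 0, 0],
        ![pencil α β 2, 0, -pencil α β 0], ![0, pencil α β 2, -pencil α β 1], t1, t2} =
          Syz ![pencil α β 0, pencil α β 1, pencil α β 2]) ∧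
    ∀ S : Finset (Fin 3 → Rk k), Submodule.span (Rk k) (S : Set (Fin 3 → Rk k)) =
      Syz ![pencil α β 0, pencil α β 1, pencil α β 2] → 6 ≤ S.card := by
  obtain ⟨c, hc⟩ := exists_det_ne_zero h hg
  have hp : ![pencil α β 0, pencil α β 1, pencil α β 2] = pencil α β :=
    FinVec.etaExpand_eq (pencil α β)
  rw [hp]
  obtain ⟨k1, k2, k3⟩ := koszul_mem_syzPiece α β
  refine ⟨⟨minors α β, syzOne α β, syzTwo α β, ?_, ?_, ?_, k1, k2, k3, ?_⟩, fun S hS =>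
    six_le_card h hc hS⟩
  · exact mem_syzPiece (by norm_num) (by norm_num) (bihom_minors α β) (sum_minors_mul α β)
  · exact mem_syzPiece (by norm_num) (by norm_num) (bihom_syzOne α β) (sum_syzOne α β)
  · exact mem_syzPiece (by norm_num) (by norm_num) (bihom_syzTwo α β) (sum_syzTwo α β)
  · exact (congrArg (Submodule.span _) (range_syzGens α β)).symm.trans (span_syzGens h hc)

end BidegSyz

/-- In the generic case, `Syz(p)` has six minimal generators: one of bidegree
`(6,1)`, the three Koszul syzygies of bidegree `(4,2)`, and two of bidegree `(3,3)`. -/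
theorem statement7 {k : Type*} [Field k] [IsAlgClosed k] (p0 p1 p2 : Rk k)
    (h0 : Bihom p0 2 1) (h1 : Bihom p1 2 1) (h2 : Bihom p2 2 1)
    (hncz : NoCommonZeros p0 p1 p2) (hgen : BidegGeneric p0 p1 p2) :
    (∃ s t1 t2 : Fin 3 → Rk k,
      s ∈ SyzPiece ![p0, p1, p2] 6 1 ∧
      t1 ∈ SyzPiece ![p0, p1, p2] 3 3 ∧ t2 ∈ SyzPiece ![p0, p1, p2] 3 3 ∧
      (![p1, -p0, 0] : Fin 3 → Rk k) ∈ SyzPiece ![p0, p1, p2] 4 2 ∧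
      (![p2, 0, -p0] : Fin 3 → Rk k) ∈ SyzPiece ![p0, p1, p2] 4 2 ∧
      (![0, p2, -p1] : Fin 3 → Rk k) ∈ SyzPiece ![p0, p1, p2] 4 2 ∧
      Submodule.span (Rk k)
          {s, ![p1, -p0, 0], ![p2, 0, -p0], ![0, p2, -p1], t1, t2}
        = Syz ![p0, p1, p2]) ∧
    ∀ S : Finset (Fin 3 → Rk k),
      Submodule.span (Rk k) (S : Set (Fin 3 → Rk k)) = Syz ![p0, p1, p2] → 6 ≤ S.card := by
  obtain ⟨a0, b0, rfl⟩ := BidegSyz.exists_quad_decomp h0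
  obtain ⟨a1, b1, rfl⟩ := BidegSyz.exists_quad_decomp h1
  obtain ⟨a2, b2, rfl⟩ := BidegSyz.exists_quad_decomp h2
  exact BidegSyz.exists_minimal_generators (α := ![a0, a1, a2]) (β := ![b0, b1, b2]) hncz hgen
end
end
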